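/- In the resolvent-sequence setting, if (H3) holds, then for every ε with 0 < ε < β/12: λₙ⁴ ∫_{4ε}^{β−4ε} |v¹ₙ|² dx → 0 and λₙ² ∫_{4ε}^{β−4ε} |v¹ₙ′|² dx → 0 as n → ∞. -/

import Mathlib

open Set Filter MeasureTheory

noncomputable section

/-- The resolvent-sequence setting for the locally damped Bresse system with
parameter `ℓ`: a sequence of nonzero frequencies `lam n` with `|lam n| → ∞`,
solutions `Uₙ = (v1,…,v6)` and right-hand sides `Fₙ = (f1,…,f6)` of the resolvent
equations `(lam n)^ℓ (i (lam n) I − 𝒜) Uₙ = Fₙ`, with `‖Uₙ‖_H = 1` and `‖Fₙ‖_H → 0`. -/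
structure BresseSetting (ρ₁ ρ₂ k₁ k₂ k₃ l L β a₀ : ℝ) (ℓ : ℕ) where
  lam : ℕ → ℝ
  v1 : ℕ → ℝ → ℂ
  v2 : ℕ → ℝ → ℂ
  v3 : ℕ → ℝ → ℂ
  v4 : ℕ → ℝ → ℂ
  v5 : ℕ → ℝ → ℂ
  v6 : ℕ → ℝ → ℂ
  f1 : ℕ → ℝ → ℂ
  f2 : ℕ → ℝ → ℂ
  f3 : ℕ → ℝ → ℂ
  f4 : ℕ → ℝ → ℂ
  f5 : ℕ → ℝ → ℂ
  f6 : ℕ → ℝ → ℂ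
  lam_ne : ∀ n, lam n ≠ 0
  lam_tendsto : Tendsto (fun n => |lam n|) atTop atTop
  reg_v1 : ∀ n, ContDiffOn ℝ 2 (v1 n) (Icc 0 L)
  reg_v3 : ∀ n, ContDiffOn ℝ 2 (v3 n) (Icc 0 L)
  reg_v5 : ∀ n, ContDiffOn ℝ 1 (v5 n) (Icc 0 L)
  reg_v5_left : ∀ n, ContDiffOn ℝ 2 (v5 n) (Icc 0 β)
  reg_v5_right : ∀ n, ContDiffOn ℝ 2 (v5 n) (Icc β L)
  reg_v2 : ∀ n, ContDiffOn ℝ 1 (v2 n) (Icc 0 L)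
  reg_v4 : ∀ n, ContDiffOn ℝ 1 (v4 n) (Icc 0 L)
  reg_v6 : ∀ n, ContDiffOn ℝ 1 (v6 n) (Icc 0 L)
  reg_f1 : ∀ n, ContDiffOn ℝ 1 (f1 n) (Icc 0 L)
  reg_f3 : ∀ n, ContDiffOn ℝ 1 (f3 n) (Icc 0 L)
  reg_f5 : ∀ n, ContDiffOn ℝ 1 (f5 n) (Icc 0 L)
  reg_f2 : ∀ n, ContinuousOn (f2 n) (Icc 0 L)
  reg_f4 : ∀ n, ContinuousOn (f4 n) (Icc 0 L)
  reg_f6 : ∀ n, ContinuousOn (f6 n) (Icc 0 L)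
  bc_zero : ∀ n, v1 n 0 = 0 ∧ v2 n 0 = 0 ∧ v3 n 0 = 0 ∧ v4 n 0 = 0 ∧ v5 n 0 = 0 ∧
      v6 n 0 = 0 ∧ f1 n 0 = 0 ∧ f3 n 0 = 0 ∧ f5 n 0 = 0
  bc_L : ∀ n, v1 n L = 0 ∧ v2 n L = 0 ∧ v3 n L = 0 ∧ v4 n L = 0 ∧ v5 n L = 0 ∧
      v6 n L = 0 ∧ f1 n L = 0 ∧ f3 n L = 0 ∧ f5 n L = 0
  eq1 : ∀ n, ∀ x ∈ Ioo (0 : ℝ) β ∪ Ioo β L,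
      Complex.I * (lam n : ℂ) * v1 n x - v2 n x = (lam n : ℂ) ^ (-(ℓ : ℤ)) * f1 n x
  eq2 : ∀ n, ∀ x ∈ Ioo (0 : ℝ) β ∪ Ioo β L,
      Complex.I * (lam n : ℂ) * (ρ₁ : ℂ) * v2 n x
        - (k₁ : ℂ) * deriv (fun y => deriv (v1 n) y + v3 n y + (l : ℂ) * v5 n y) x
        - (l : ℂ) * (k₃ : ℂ) * (deriv (v5 n) x - (l : ℂ) * v1 n x)
        = (ρ₁ : ℂ) * (lam n : ℂ) ^ (-(ℓ : ℤ)) * f2 n x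
  eq3 : ∀ n, ∀ x ∈ Ioo (0 : ℝ) β ∪ Ioo β L,
      Complex.I * (lam n : ℂ) * v3 n x - v4 n x = (lam n : ℂ) ^ (-(ℓ : ℤ)) * f3 n x
  eq4 : ∀ n, ∀ x ∈ Ioo (0 : ℝ) β ∪ Ioo β L,
      Complex.I * (lam n : ℂ) * (ρ₂ : ℂ) * v4 n x
        - (k₂ : ℂ) * deriv (deriv (v3 n)) x
        + (k₁ : ℂ) * (deriv (v1 n) x + v3 n x + (l : ℂ) * v5 n x)
        = (ρ₂ : ℂ) * (lam n : ℂ) ^ (-(ℓ : ℤ)) * f4 n x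
  eq5 : ∀ n, ∀ x ∈ Ioo (0 : ℝ) β ∪ Ioo β L,
      Complex.I * (lam n : ℂ) * v5 n x - v6 n x = (lam n : ℂ) ^ (-(ℓ : ℤ)) * f5 n x
  eq6 : ∀ n, ∀ x ∈ Ioo (0 : ℝ) β ∪ Ioo β L,
      Complex.I * (lam n : ℂ) * (ρ₁ : ℂ) * v6 n x
        - (k₃ : ℂ) * deriv (fun y => deriv (v5 n) y - (l : ℂ) * v1 n y) x
        + (l : ℂ) * (k₁ : ℂ) * (deriv (v1 n) x + v3 n x + (l : ℂ) * v5 n x)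
        + (if x < β then (a₀ : ℂ) else 0) * v6 n x
        = (ρ₁ : ℂ) * (lam n : ℂ) ^ (-(ℓ : ℤ)) * f6 n x
  normU : ∀ n, (∫ x in (0 : ℝ)..L,
      (k₁ * ‖deriv (v1 n) x + v3 n x + (l : ℂ) * v5 n x‖ ^ 2 + ρ₁ * ‖v2 n x‖ ^ 2
        + k₂ * ‖deriv (v3 n) x‖ ^ 2 + ρ₂ * ‖v4 n x‖ ^ 2
        + k₃ * ‖deriv (v5 n) x - (l : ℂ) * v1 n x‖ ^ 2 + ρ₁ * ‖v6 n x‖ ^ 2)) = 1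
  normF : Tendsto (fun n => ∫ x in (0 : ℝ)..L,
      (k₁ * ‖deriv (f1 n) x + f3 n x + (l : ℂ) * f5 n x‖ ^ 2 + ρ₁ * ‖f2 n x‖ ^ 2
        + k₂ * ‖deriv (f3 n) x‖ ^ 2 + ρ₂ * ‖f4 n x‖ ^ 2
        + k₃ * ‖deriv (f5 n) x - (l : ℂ) * f1 n x‖ ^ 2 + ρ₁ * ‖f6 n x‖ ^ 2))
      atTop (nhds 0)


namespace BL

open ComplexConjugate

/-- weighted local squared norm -/
def Nm (lam : ℕ → ℝ) (j : ℤ) (f : ℕ → ℝ → ℂ) (a b : ℝ) (n : ℕ) : ℝ :=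
  (|lam n| ^ j) ^ 2 * ∫ x in a..b, ‖f n x‖ ^ 2

/-- `δ n * Nm` tends to zero on every compact subinterval -/
def Cl (lam : ℕ → ℝ) (β : ℝ) (δ : ℕ → ℝ) (j : ℤ) (f : ℕ → ℝ → ℂ) : Prop :=
  ∀ a b, 0 < a → a < b → b < β →
    Tendsto (fun n => δ n * Nm lam j f a b n) atTop (nhds 0)

def Ct (β : ℝ) (f : ℕ → ℝ → ℂ) : Prop := ∀ n, ContinuousOn (f n) (Ioo 0 β)

def Sm (lam : ℕ → ℝ) (β : ℝ) (j : ℤ) (f : ℕ → ℝ → ℂ) : Prop :=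
  Ct β f ∧ Cl lam β (fun _ => 1) j f

def Bd (lam : ℕ → ℝ) (β : ℝ) (j : ℤ) (f : ℕ → ℝ → ℂ) : Prop :=
  Ct β f ∧ ∀ a b, 0 < a → a < b → b < β → ∀ δ : ℕ → ℝ, (∀ n, 0 ≤ δ n) →
    Tendsto δ atTop (nhds 0) → Tendsto (fun n => δ n * Nm lam j f a b n) atTop (nhds 0)

variable {lam : ℕ → ℝ} {β : ℝ}

lemma Nm_nonneg {j : ℤ} {f : ℕ → ℝ → ℂ} {a b : ℝ} (hab : a < b) (n : ℕ) :
    0 ≤ Nm lam j f a b n := by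
  unfold Nm
  have : 0 ≤ ∫ x in a..b, ‖f n x‖ ^ 2 :=
    intervalIntegral.integral_nonneg hab.le (fun x _ => by positivity)
  positivity

lemma sub_Icc {a b : ℝ} (ha : 0 < a) (hb : b < β) : Icc a b ⊆ Ioo 0 β := fun _ hx =>
  ⟨ha.trans_le hx.1, hx.2.trans_lt hb⟩

lemma Ct.ii {f : ℕ → ℝ → ℂ} (hf : Ct β f) {a b : ℝ} (ha : 0 < a) (hab : a < b) (hb : b < β)
    (n : ℕ) : IntervalIntegrable (fun x => ‖f n x‖ ^ 2) volume a b := by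
  apply ContinuousOn.intervalIntegrable
  rw [uIcc_of_le hab.le]
  exact (((hf n).mono (sub_Icc ha hb)).norm).pow 2

lemma Nm_add {j : ℤ} {f g : ℕ → ℝ → ℂ} (hf : Ct β f) (hg : Ct β g) {a b : ℝ}
    (ha : 0 < a) (hab : a < b) (hb : b < β) (n : ℕ) :
    Nm lam j (fun n x => f n x + g n x) a b n ≤ 2 * Nm lam j f a b n + 2 * Nm lam j g a b n := by
  unfold Nm
  have h : (∫ x in a..b, ‖f n x + g n x‖ ^ 2) ≤
      ∫ x in a..b, (2 * ‖f n x‖ ^ 2 + 2 * ‖g n x‖ ^ 2) := by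
    apply intervalIntegral.integral_mono_on hab.le
    · exact Ct.ii (f := fun n x => f n x + g n x) (fun n => (hf n).add (hg n)) ha hab hb n
    · exact ((hf.ii ha hab hb n).const_mul 2).add ((hg.ii ha hab hb n).const_mul 2)
    · intro x _
      have h1 := norm_add_le (f n x) (g n x)
      have h2 := norm_nonneg (f n x + g n x)
      nlinarith [sq_nonneg (‖f n x‖ - ‖g n x‖)]
  rw [intervalIntegral.integral_add ((hf.ii ha hab hb n).const_mul 2)
    ((hg.ii ha hab hb n).const_mul 2), intervalIntegral.integral_const_mul,
    intervalIntegral.integral_const_mul] at h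
  have : 0 ≤ (|lam n| ^ j) ^ 2 := by positivity
  nlinarith [mul_le_mul_of_nonneg_left h this]

lemma Nm_congr {j : ℤ} {f g : ℕ → ℝ → ℂ} (h : ∀ n, ∀ x ∈ Ioo 0 β, f n x = g n x) {a b : ℝ}
    (ha : 0 < a) (hab : a < b) (hb : b < β) (n : ℕ) : Nm lam j f a b n = Nm lam j g a b n := by
  unfold Nm
  congr 1
  apply intervalIntegral.integral_congr
  intro x hx
  rw [uIcc_of_le hab.le] at hx
  simp only [h n x (sub_Icc ha hb hx)]

lemma Nm_const {j : ℤ} {f : ℕ → ℝ → ℂ} (c : ℂ) {a b : ℝ} (n : ℕ) :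
    Nm lam j (fun n x => c * f n x) a b n = ‖c‖ ^ 2 * Nm lam j f a b n := by
  unfold Nm
  simp only [norm_mul, mul_pow, intervalIntegral.integral_const_mul]
  ring

lemma Nm_pow (hl : ∀ n, lam n ≠ 0) {j : ℤ} {f : ℕ → ℝ → ℂ} (k : ℕ) {a b : ℝ} (n : ℕ) :
    Nm lam (j - k) (fun n x => (lam n : ℂ) ^ k * f n x) a b n = Nm lam j f a b n := by
  unfold Nm
  simp only [norm_mul, mul_pow, intervalIntegral.integral_const_mul, norm_pow, Complex.norm_real,
    Real.norm_eq_abs]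
  have : |lam n| ≠ 0 := abs_ne_zero.2 (hl n)
  rw [zpow_sub₀ this, zpow_natCast]
  field_simp

lemma Nm_mono {i j : ℤ} (hij : i ≤ j) {f : ℕ → ℝ → ℂ} {a b : ℝ} (hab : a < b) (n : ℕ)
    (h1 : 1 ≤ |lam n|) : Nm lam i f a b n ≤ Nm lam j f a b n := by
  unfold Nm
  have : 0 ≤ ∫ x in a..b, ‖f n x‖ ^ 2 :=
    intervalIntegral.integral_nonneg hab.le (fun x _ => by positivity)
  have h2 : |lam n| ^ i ≤ |lam n| ^ j := zpow_le_zpow_right₀ h1 hij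
  have h3 : 0 ≤ |lam n| ^ i := by positivity
  gcongr

section
variable {δ : ℕ → ℝ} {j : ℤ} {f g : ℕ → ℝ → ℂ} {a b : ℝ}

lemma T_add (hδ : ∀ n, 0 ≤ δ n) (hf : Ct β f) (hg : Ct β g)
    (ha : 0 < a) (hab : a < b) (hb : b < β)
    (h1 : Tendsto (fun n => δ n * Nm lam j f a b n) atTop (nhds 0))
    (h2 : Tendsto (fun n => δ n * Nm lam j g a b n) atTop (nhds 0)) :
    Tendsto (fun n => δ n * Nm lam j (fun n x => f n x + g n x) a b n) atTop (nhds 0) := by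
  have h3 := (h1.const_mul 2).add (h2.const_mul 2)
  simp only [mul_zero, add_zero] at h3
  refine squeeze_zero (fun n => mul_nonneg (hδ n) (Nm_nonneg hab n)) (fun n => ?_) h3
  have := mul_le_mul_of_nonneg_left (Nm_add (lam := lam) (j := j) hf hg ha hab hb n) (hδ n)
  linarith

lemma T_mono (hlt : Tendsto (fun n => |lam n|) atTop atTop) {i : ℤ} (hij : i ≤ j)
    (hδ : ∀ n, 0 ≤ δ n) (hab : a < b)
    (h1 : Tendsto (fun n => δ n * Nm lam j f a b n) atTop (nhds 0)) :
    Tendsto (fun n => δ n * Nm lam i f a b n) atTop (nhds 0) := by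
  refine squeeze_zero' (Eventually.of_forall fun n => mul_nonneg (hδ n) (Nm_nonneg hab n)) ?_ h1
  filter_upwards [hlt.eventually_ge_atTop 1] with n hn
  exact mul_le_mul_of_nonneg_left (Nm_mono hij hab n hn) (hδ n)

lemma Sm.add (hf : Sm lam β j f) (hg : Sm lam β j g) : Sm lam β j (fun n x => f n x + g n x) :=
  ⟨fun n => (hf.1 n).add (hg.1 n), fun a b ha hab hb =>
    T_add (fun _ => zero_le_one) hf.1 hg.1 ha hab hb (hf.2 a b ha hab hb) (hg.2 a b ha hab hb)⟩

lemma Bd.add (hf : Bd lam β j f) (hg : Bd lam β j g) : Bd lam β j (fun n x => f n x + g n x) :=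
  ⟨fun n => (hf.1 n).add (hg.1 n), fun a b ha hab hb δ h0 h1 =>
    T_add h0 hf.1 hg.1 ha hab hb (hf.2 a b ha hab hb δ h0 h1) (hg.2 a b ha hab hb δ h0 h1)⟩

lemma Sm.mono (hlt : Tendsto (fun n => |lam n|) atTop atTop) {i : ℤ} (hf : Sm lam β j f)
    (hij : i ≤ j) : Sm lam β i f :=
  ⟨hf.1, fun a b ha hab hb => T_mono hlt hij (fun _ => zero_le_one) hab (hf.2 a b ha hab hb)⟩

lemma Bd.mono (hlt : Tendsto (fun n => |lam n|) atTop atTop) {i : ℤ} (hf : Bd lam β j f)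
    (hij : i ≤ j) : Bd lam β i f :=
  ⟨hf.1, fun a b ha hab hb δ h0 h1 => T_mono hlt hij h0 hab (hf.2 a b ha hab hb δ h0 h1)⟩

lemma Sm.smul (hf : Sm lam β j f) (c : ℂ) : Sm lam β j (fun n x => c * f n x) :=
  ⟨fun n => continuousOn_const.mul (hf.1 n), fun a b ha hab hb => by
    have := (hf.2 a b ha hab hb).const_mul (‖c‖ ^ 2)
    simp only [mul_zero] at this
    refine this.congr fun n => ?_
    rw [Nm_const]; ring⟩

lemma Bd.smul (hf : Bd lam β j f) (c : ℂ) : Bd lam β j (fun n x => c * f n x) :=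
  ⟨fun n => continuousOn_const.mul (hf.1 n), fun a b ha hab hb δ h0 h1 => by
    have := (hf.2 a b ha hab hb δ h0 h1).const_mul (‖c‖ ^ 2)
    simp only [mul_zero] at this
    refine this.congr fun n => ?_
    rw [Nm_const]; ring⟩

lemma Sm.pow (hl : ∀ n, lam n ≠ 0) (hf : Sm lam β j f) (k : ℕ) :
    Sm lam β (j - k) (fun n x => (lam n : ℂ) ^ k * f n x) :=
  ⟨fun n => continuousOn_const.mul (hf.1 n), fun a b ha hab hb => by
    simp only [Nm_pow hl]; exact hf.2 a b ha hab hb⟩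

lemma Bd.pow (hl : ∀ n, lam n ≠ 0) (hf : Bd lam β j f) (k : ℕ) :
    Bd lam β (j - k) (fun n x => (lam n : ℂ) ^ k * f n x) :=
  ⟨fun n => continuousOn_const.mul (hf.1 n), fun a b ha hab hb => by
    simp only [Nm_pow hl]; exact hf.2 a b ha hab hb⟩

lemma Sm.congr (hf : Sm lam β j f) (h : ∀ n, ∀ x ∈ Ioo 0 β, g n x = f n x) : Sm lam β j g :=
  ⟨fun n => (hf.1 n).congr (h n), fun a b ha hab hb => by
    refine (hf.2 a b ha hab hb).congr fun n => ?_
    rw [Nm_congr h ha hab hb]⟩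

lemma Bd.congr (hf : Bd lam β j f) (h : ∀ n, ∀ x ∈ Ioo 0 β, g n x = f n x) : Bd lam β j g :=
  ⟨fun n => (hf.1 n).congr (h n), fun a b ha hab hb δ h0 h1 => by
    refine (hf.2 a b ha hab hb δ h0 h1).congr fun n => ?_
    rw [Nm_congr h ha hab hb]⟩

lemma Sm.bd (hf : Sm lam β j f) : Bd lam β j f :=
  ⟨hf.1, fun a b ha hab hb δ h0 h1 => by
    have := h1.mul (hf.2 a b ha hab hb)
    simpa using this⟩

lemma Bd.sm (hl : ∀ n, lam n ≠ 0) (hlt : Tendsto (fun n => |lam n|) atTop atTop) {i : ℤ}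
    (hf : Bd lam β j f) (hij : i + 1 ≤ j) : Sm lam β i f :=
  ⟨hf.1, fun a b ha hab hb => by
    have h1 : Tendsto (fun n => (|lam n|⁻¹) ^ 2) atTop (nhds 0) := by
      simpa using (hlt.inv_tendsto_atTop).pow 2
    have := hf.2 a b ha hab hb (fun n => (|lam n|⁻¹) ^ 2) (fun n => by positivity) h1
    refine T_mono (j := j - 1) hlt (by omega) (fun _ => zero_le_one) hab
      (this.congr fun n => ?_)
    have h0 : |lam n| ≠ 0 := abs_ne_zero.2 (hl n)
    unfold Nm
    rw [zpow_sub_one₀ h0]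
    ring⟩
end

/-- integrals tend to zero -/
def Zr (a b : ℝ) (F : ℕ → ℝ → ℂ) : Prop :=
  (∀ n, ContinuousOn (F n) (Icc a b)) ∧
    Tendsto (fun n => ∫ x in a..b, F n x) atTop (nhds 0)

section
variable {a b : ℝ} {F G : ℕ → ℝ → ℂ}

lemma ii_of (hab : a < b) {f : ℝ → ℂ} (h : ContinuousOn f (Icc a b)) :
    IntervalIntegrable f volume a b := by
  apply ContinuousOn.intervalIntegrable
  rwa [uIcc_of_le hab.le]

lemma Zr.add (hab : a < b) (hF : Zr a b F) (hG : Zr a b G) :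
    Zr a b (fun n x => F n x + G n x) :=
  ⟨fun n => (hF.1 n).add (hG.1 n), by
    have := hF.2.add hG.2
    simp only [add_zero] at this
    refine this.congr fun n => ?_
    rw [intervalIntegral.integral_add (ii_of hab (hF.1 n)) (ii_of hab (hG.1 n))]⟩

lemma Zr.smul (hF : Zr a b F) (c : ℂ) : Zr a b (fun n x => c * F n x) :=
  ⟨fun n => continuousOn_const.mul (hF.1 n), by
    have := hF.2.const_mul c
    simp only [mul_zero] at this
    refine this.congr fun n => ?_
    rw [intervalIntegral.integral_const_mul]⟩

lemma Zr.congr (hab : a < b) (hF : Zr a b F) (h : ∀ n, ∀ x ∈ Icc a b, G n x = F n x) :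
    Zr a b G :=
  ⟨fun n => (hF.1 n).congr (h n), by
    refine hF.2.congr fun n => ?_
    apply intervalIntegral.integral_congr
    intro x hx
    rw [uIcc_of_le hab.le] at hx
    exact (h n x hx).symm⟩

lemma cs_aux (hab : a < b) {f g : ℝ → ℂ} (hf : ContinuousOn f (Icc a b))
    (hg : ContinuousOn g (Icc a b)) (q : ℝ → ℝ) (C : ℝ) (hq : ∀ x ∈ Icc a b, |q x| ≤ C) :
    ‖∫ x in a..b, (q x : ℂ) * f x * conj (g x)‖ ^ 2 ≤
      C ^ 2 * (∫ x in a..b, ‖f x‖ ^ 2) * ∫ x in a..b, ‖g x‖ ^ 2 := by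
  have hC : 0 ≤ C := (abs_nonneg _).trans (hq a ⟨le_rfl, hab.le⟩)
  have i1 : IntervalIntegrable (fun x => ‖f x‖ ^ 2) volume a b := by
    apply ContinuousOn.intervalIntegrable; rw [uIcc_of_le hab.le]; exact hf.norm.pow 2
  have i2 : IntervalIntegrable (fun x => ‖g x‖ ^ 2) volume a b := by
    apply ContinuousOn.intervalIntegrable; rw [uIcc_of_le hab.le]; exact hg.norm.pow 2
  have i3 : IntervalIntegrable (fun x => ‖f x‖ * ‖g x‖) volume a b := by
    apply ContinuousOn.intervalIntegrable; rw [uIcc_of_le hab.le]; exact hf.norm.mul hg.norm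
  set A := ∫ x in a..b, ‖f x‖ ^ 2
  set B := ∫ x in a..b, ‖g x‖ ^ 2
  set M := ∫ x in a..b, ‖f x‖ * ‖g x‖
  have hM : 0 ≤ M := intervalIntegral.integral_nonneg hab.le (fun x _ => by positivity)
  have key : ∀ t : ℝ, 0 ≤ A * (t * t) + (-2 * M) * t + B := by
    intro t
    have : 0 ≤ ∫ x in a..b, (t * t * ‖f x‖ ^ 2 + (-2 * t) * (‖f x‖ * ‖g x‖) + ‖g x‖ ^ 2) :=
      intervalIntegral.integral_nonneg hab.le
        (fun x _ => by nlinarith [sq_nonneg (t * ‖f x‖ - ‖g x‖)])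
    rw [intervalIntegral.integral_add ((i1.const_mul _).add (i3.const_mul _)) i2,
      intervalIntegral.integral_add (i1.const_mul _) (i3.const_mul _),
      intervalIntegral.integral_const_mul, intervalIntegral.integral_const_mul] at this
    have e : A * (t * t) + (-2 * M) * t + B = t * t * A + -2 * t * M + B := by ring
    rw [e]; exact this
  have hd := discrim_le_zero key
  unfold discrim at hd
  have hM2 : M ^ 2 ≤ A * B := by nlinarith
  have hle : ‖∫ x in a..b, (q x : ℂ) * f x * conj (g x)‖ ≤ C * M := by
    have : ‖∫ x in a..b, (q x : ℂ) * f x * conj (g x)‖ ≤ ∫ x in a..b, C * (‖f x‖ * ‖g x‖) := by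
      apply intervalIntegral.norm_integral_le_of_norm_le hab.le _ (i3.const_mul C)
      refine Eventually.of_forall fun x hx => ?_
      have hx' : x ∈ Icc a b := ⟨hx.1.le, hx.2⟩
      rw [norm_mul, norm_mul, RCLike.norm_conj, Complex.norm_real, Real.norm_eq_abs, mul_assoc]
      exact mul_le_mul_of_nonneg_right (hq x hx') (by positivity)
    rwa [intervalIntegral.integral_const_mul] at this
  calc _ ≤ (C * M) ^ 2 := by gcongr
    _ = C ^ 2 * M ^ 2 := by ring
    _ ≤ C ^ 2 * (A * B) := by gcongr
    _ = _ := by ring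

lemma Zr.SB (hl : ∀ n, lam n ≠ 0) (hlt : Tendsto (fun n => |lam n|) atTop atTop)
    (ha : 0 < a) (hab : a < b) (hb : b < β) {j k : ℤ} {f g : ℕ → ℝ → ℂ} (hf : Sm lam β j f)
    (hg : Bd lam β k g) (m : ℕ) (hm : m ≤ j + k) (q : ℝ → ℝ) (hq : Continuous q) :
    Zr a b (fun n x => (lam n : ℂ) ^ m * ((q x : ℂ) * f n x * conj (g n x))) := by
  have cf := fun n => (hf.1 n).mono (sub_Icc (β := β) ha hb)
  have cg := fun n => (hg.1 n).mono (sub_Icc (β := β) ha hb)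
  have cq : Continuous (fun x => (q x : ℂ)) := Complex.continuous_ofReal.comp hq
  refine ⟨fun n => ?_, ?_⟩
  · exact continuousOn_const.mul ((cq.continuousOn.mul (cf n)).mul (Complex.continuous_conj.comp_continuousOn (cg n)))
  · obtain ⟨C, hC⟩ := (isCompact_Icc (a := a) (b := b)).exists_bound_of_continuousOn
      (f := q) hq.continuousOn
    have h1 := hf.2 a b ha hab hb
    simp only [one_mul] at h1
    have h2 := (hg.2 a b ha hab hb _ (fun n => Nm_nonneg hab n) h1).const_mul (C ^ 2)
    simp only [mul_zero] at h2
    have h3 : Tendsto (fun n => ‖∫ x in a..b, (lam n : ℂ) ^ m *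
        ((q x : ℂ) * f n x * conj (g n x))‖ ^ 2) atTop (nhds 0) := by
      refine squeeze_zero' (Eventually.of_forall fun n => by positivity) ?_ h2
      filter_upwards [hlt.eventually_ge_atTop 1] with n hn
      rw [intervalIntegral.integral_const_mul, norm_mul, mul_pow, norm_pow, Complex.norm_real,
        Real.norm_eq_abs]
      have c := cs_aux hab (cf n) (cg n) q C (fun x hx => hC x hx)
      have h0 : |lam n| ≠ 0 := abs_ne_zero.2 (hl n)
      have e : |lam n| ^ m ≤ |lam n| ^ j * |lam n| ^ k := by
        rw [← zpow_add₀ h0, ← zpow_natCast]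
        exact zpow_le_zpow_right₀ hn hm
      calc _ ≤ (|lam n| ^ j * |lam n| ^ k) ^ 2 *
            (C ^ 2 * (∫ x in a..b, ‖f n x‖ ^ 2) * ∫ x in a..b, ‖g n x‖ ^ 2) := by gcongr
        _ = _ := by unfold Nm; ring
    have h4 := h3.sqrt
    simp only [Real.sqrt_sq (norm_nonneg _), Real.sqrt_zero] at h4
    exact tendsto_zero_iff_norm_tendsto_zero.2 h4

lemma Zr.cj (hF : Zr a b F) : Zr a b (fun n x => conj (F n x)) :=
  ⟨fun n => Complex.continuous_conj.comp_continuousOn (hF.1 n), by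
    have := (Complex.continuous_conj.tendsto 0).comp hF.2
    simp only [map_zero] at this
    refine this.congr fun n => ?_
    simp only [Function.comp, intervalIntegral]
    rw [integral_conj, integral_conj, map_sub]⟩

lemma Zr.BS (hl : ∀ n, lam n ≠ 0) (hlt : Tendsto (fun n => |lam n|) atTop atTop)
    (ha : 0 < a) (hab : a < b) (hb : b < β) {j k : ℤ} {f g : ℕ → ℝ → ℂ} (hf : Bd lam β j f)
    (hg : Sm lam β k g) (m : ℕ) (hm : m ≤ j + k) (q : ℝ → ℝ) (hq : Continuous q) :
    Zr a b (fun n x => (lam n : ℂ) ^ m * ((q x : ℂ) * f n x * conj (g n x))) := by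
  have h := (Zr.SB hl hlt ha hab hb hg hf m (by omega) q hq).cj
  refine h.congr hab fun n x _ => ?_
  simp only [map_mul, map_pow, Complex.conj_ofReal, Complex.conj_conj]
  ring

end


/-- polynomial bump -/
def bp (a b x : ℝ) : ℝ := (x - a) ^ 2 * (b - x) ^ 2
def bp1 (a b x : ℝ) : ℝ := 2 * (x - a) * (b - x) ^ 2 - 2 * (x - a) ^ 2 * (b - x)
def bp2 (a b x : ℝ) : ℝ := 2 * (b - x) ^ 2 - 8 * (x - a) * (b - x) + 2 * (x - a) ^ 2

lemma bp_cont (a b : ℝ) : Continuous (bp a b) := by unfold bp; fun_prop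
lemma bp1_cont (a b : ℝ) : Continuous (bp1 a b) := by unfold bp1; fun_prop
lemma bp2_cont (a b : ℝ) : Continuous (bp2 a b) := by unfold bp2; fun_prop

lemma bp_der (a b x : ℝ) : HasDerivAt (bp a b) (bp1 a b x) x := by
  have h1 := ((hasDerivAt_id x).sub_const a).pow 2
  have h2 := ((hasDerivAt_id x).const_sub b).pow 2
  refine (h1.mul h2).congr_deriv ?_
  simp [bp1]; ring

lemma bp1_der (a b x : ℝ) : HasDerivAt (bp1 a b) (bp2 a b x) x := by
  have h1 := ((hasDerivAt_id x).sub_const a)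
  have h2 := ((hasDerivAt_id x).const_sub b)
  have h := ((h1.const_mul 2).mul (h2.pow 2)).sub (((h1.pow 2).const_mul 2).mul h2)
  refine h.congr_deriv ?_
  simp [bp2]; ring

lemma Zr.ibp {a b : ℝ} (ha : 0 < a) (hab : a < b) (hb : b < β) {q q1 : ℝ → ℝ}
    (hq : ∀ x, HasDerivAt q (q1 x) x) (hq1 : Continuous q1) (qa : q a = 0) (qb : q b = 0)
    {f f1 g g1 : ℕ → ℝ → ℂ} (hf : ∀ n, ∀ x ∈ Ioo 0 β, HasDerivAt (f n) (f1 n x) x)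
    (hg : ∀ n, ∀ x ∈ Ioo 0 β, HasDerivAt (g n) (g1 n x) x) (cf1 : Ct β f1) (cg1 : Ct β g1)
    (m : ℕ) : Zr a b (fun n x => (lam n : ℂ) ^ m * ((q x : ℂ) * f1 n x * conj (g n x)
      + (q x : ℂ) * f n x * conj (g1 n x) + (q1 x : ℂ) * f n x * conj (g n x))) := by
  have cq : Continuous q := continuous_iff_continuousAt.2 fun x => (hq x).continuousAt
  have cq' : Continuous (fun x => (q x : ℂ)) := Complex.continuous_ofReal.comp cq
  have cq1' : Continuous (fun x => (q1 x : ℂ)) := Complex.continuous_ofReal.comp hq1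
  have S := sub_Icc (β := β) ha hb
  have cf : ∀ n, ContinuousOn (f n) (Icc a b) := fun n x hx =>
    (hf n x (S hx)).continuousAt.continuousWithinAt
  have cg : ∀ n, ContinuousOn (fun x => conj (g n x)) (Icc a b) := fun n x hx =>
    (Complex.continuous_conj.continuousAt.comp (hg n x (S hx)).continuousAt).continuousWithinAt
  have cg1' : ∀ n, ContinuousOn (fun x => conj (g1 n x)) (Icc a b) := fun n =>
    Complex.continuous_conj.comp_continuousOn ((cg1 n).mono S)
  have c : ∀ n, ContinuousOn (fun x => (q x : ℂ) * f1 n x * conj (g n x)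
      + (q x : ℂ) * f n x * conj (g1 n x) + (q1 x : ℂ) * f n x * conj (g n x)) (Icc a b) := by
    intro n
    exact (((cq'.continuousOn.mul ((cf1 n).mono S)).mul (cg n)).add
      ((cq'.continuousOn.mul (cf n)).mul (cg1' n))).add
      ((cq1'.continuousOn.mul (cf n)).mul (cg n))
  refine ⟨fun n => continuousOn_const.mul (c n), ?_⟩
  refine tendsto_const_nhds.congr fun n => ?_
  rw [intervalIntegral.integral_const_mul]
  have := intervalIntegral.integral_eq_sub_of_hasDerivAt (a := a) (b := b)
    (f := fun x => (q x : ℂ) * f n x * conj (g n x)) (f' := fun x => (q x : ℂ) * f1 n x * conj (g n x)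
      + (q x : ℂ) * f n x * conj (g1 n x) + (q1 x : ℂ) * f n x * conj (g n x)) ?_ (ii_of hab (c n))
  · rw [this, qa, qb]; simp
  · intro x hx
    rw [uIcc_of_le hab.le] at hx
    have d1 : HasDerivAt (fun x => (q x : ℂ)) (q1 x : ℂ) x := (hq x).ofReal_comp
    have d2 : HasDerivAt (fun x => conj (g n x)) (conj (g1 n x)) x := (hg n x (S hx)).star
    refine ((d1.mul (hf n x (S hx))).mul d2).congr_deriv ?_
    simp only [Pi.mul_apply]
    ring

lemma young {a b : ℝ} (hab : a < b) {K : ℝ} (hK : 0 < K) {j : ℕ} {f g : ℕ → ℝ → ℂ}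
    (cf : ∀ n, ContinuousOn (f n) (Icc a b)) (cg : ∀ n, ContinuousOn (g n) (Icc a b))
    (hg : Tendsto (fun n => ∫ x in a..b, ‖g n x‖ ^ 2) atTop (nhds 0))
    (h : Zr a b (fun n x => (bp a b x : ℂ) * ((K : ℂ) * (lam n : ℂ) ^ (2 * j) *
      (f n x * conj (f n x)) - (lam n : ℂ) ^ j * (g n x * conj (f n x))))) :
    Tendsto (fun n => ∫ x in a..b, bp a b x * ‖(lam n : ℂ) ^ j * f n x‖ ^ 2) atTop (nhds 0) := by
  obtain ⟨C, hC⟩ := (isCompact_Icc (a := a) (b := b)).exists_bound_of_continuousOn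
      (f := bp a b) (bp_cont a b).continuousOn
  have hre := (Complex.continuous_re.tendsto 0).comp h.2
  have h3 := ((hre.const_mul (2 / K)).add ((hg.const_mul (C / K ^ 2))))
  simp only [Complex.zero_re, mul_zero, add_zero] at h3
  have hbp : ∀ x, 0 ≤ bp a b x := fun x => by unfold bp; positivity
  refine squeeze_zero (fun n => intervalIntegral.integral_nonneg hab.le
    (fun x _ => mul_nonneg (hbp x) (by positivity))) (fun n => ?_) h3
  have i0 := ii_of hab (h.1 n)
  have i1 : IntervalIntegrable (fun x => ‖g n x‖ ^ 2) volume a b := by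
    apply ContinuousOn.intervalIntegrable; rw [uIcc_of_le hab.le]; exact (cg n).norm.pow 2
  have i2 : IntervalIntegrable (fun x => bp a b x * ‖(lam n : ℂ) ^ j * f n x‖ ^ 2) volume a b := by
    apply ContinuousOn.intervalIntegrable; rw [uIcc_of_le hab.le]
    exact (bp_cont a b).continuousOn.mul ((continuousOn_const.mul (cf n)).norm.pow 2)
  set F := fun x => (bp a b x : ℂ) * ((K : ℂ) * (lam n : ℂ) ^ (2 * j) *
      (f n x * conj (f n x)) - (lam n : ℂ) ^ j * (g n x * conj (f n x))) with hF
  have i3 : IntervalIntegrable (fun x => (F x).re) volume a b := by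
    apply ContinuousOn.intervalIntegrable; rw [uIcc_of_le hab.le]
    exact Complex.continuous_re.comp_continuousOn (h.1 n)
  have e : (∫ x in a..b, F x).re = ∫ x in a..b, (F x).re := by
    have := Complex.reCLM.intervalIntegral_comp_comm i0
    exact this.symm
  simp only [Function.comp]
  rw [e, ← intervalIntegral.integral_const_mul, ← intervalIntegral.integral_const_mul,
    ← intervalIntegral.integral_add (i3.const_mul _) (i1.const_mul _)]
  apply intervalIntegral.integral_mono_on hab.le i2 ((i3.const_mul _).add (i1.const_mul _))
  intro x hx
  set w := (lam n : ℂ) ^ j * f n x with hw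
  have e1 : F x = (bp a b x : ℂ) * ((K : ℂ) * (w * conj w) - g n x * conj w) := by
    simp only [hF, hw, map_mul, map_pow, Complex.conj_ofReal]
    ring
  have e2 : (F x).re = bp a b x * (K * ‖w‖ ^ 2 - (g n x * conj w).re) := by
    rw [e1, Complex.mul_conj, Complex.normSq_eq_norm_sq]
    rw [Complex.re_ofReal_mul, Complex.sub_re, ← Complex.ofReal_mul, Complex.ofReal_re]
  have e3 : (g n x * conj w).re ≤ ‖g n x‖ * ‖w‖ := by
    refine (Complex.re_le_norm _).trans ?_
    rw [norm_mul, RCLike.norm_conj]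
  have e4 : bp a b x ≤ C := (le_abs_self _).trans (hC x hx)
  have hb0 := hbp x
  rw [e2]
  have e5 : ‖w‖ ^ 2 ≤ 2 / K * (K * ‖w‖ ^ 2 - (g n x * conj w).re) + 1 / K ^ 2 * ‖g n x‖ ^ 2 := by
    have : ‖w‖ ^ 2 ≤ 2 / K * (K * ‖w‖ ^ 2 - ‖g n x‖ * ‖w‖) + 1 / K ^ 2 * ‖g n x‖ ^ 2 := by
      have : 2 / K * (K * ‖w‖ ^ 2 - ‖g n x‖ * ‖w‖) + 1 / K ^ 2 * ‖g n x‖ ^ 2 - ‖w‖ ^ 2 =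
        (‖w‖ - ‖g n x‖ / K) ^ 2 := by field_simp; ring
      nlinarith [sq_nonneg (‖w‖ - ‖g n x‖ / K)]
    have h2 : 2 / K * (K * ‖w‖ ^ 2 - ‖g n x‖ * ‖w‖) ≤ 2 / K * (K * ‖w‖ ^ 2 - (g n x * conj w).re) := by
      gcongr
    linarith
  calc _ ≤ bp a b x * (2 / K * (K * ‖w‖ ^ 2 - (g n x * conj w).re) + 1 / K ^ 2 * ‖g n x‖ ^ 2) := by
        gcongr
    _ = 2 / K * (bp a b x * (K * ‖w‖ ^ 2 - (g n x * conj w).re)) + bp a b x * (1 / K ^ 2 * ‖g n x‖ ^ 2) := by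
        ring
    _ ≤ 2 / K * (bp a b x * (K * ‖w‖ ^ 2 - (g n x * conj w).re)) + C * (1 / K ^ 2 * ‖g n x‖ ^ 2) := by
        gcongr
    _ = _ := by ring

lemma Sm_of_young {K : ℝ} (hK : 0 < K) {j : ℕ} {f g : ℕ → ℝ → ℂ}
    (cf : Ct β f) (hg : Sm lam β 0 g)
    (h : ∀ a b, 0 < a → a < b → b < β → Zr a b (fun n x => (bp a b x : ℂ) * ((K : ℂ) *
      (lam n : ℂ) ^ (2 * j) * (f n x * conj (f n x)) - (lam n : ℂ) ^ j * (g n x * conj (f n x))))) :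
    Sm lam β j f := by
  refine ⟨cf, fun a b ha hab hb => ?_⟩
  have a0 : 0 < a / 2 := by linarith
  have b0 : (b + β) / 2 < β := by linarith
  have ab0 : a / 2 < (b + β) / 2 := by linarith
  have hg1 := hg.2 _ _ a0 ab0 b0
  simp only [Nm, zpow_zero, one_pow, one_mul] at hg1
  have S := sub_Icc (β := β) a0 b0
  have hy := young ab0 hK (fun n => (cf n).mono S) (fun n => (hg.1 n).mono S) hg1 (h _ _ a0 ab0 b0)
  set m := (a / 2) ^ 2 * ((β - b) / 2) ^ 2 with hm
  have m0 : 0 < m := by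
    have : 0 < (β - b) / 2 := by linarith
    positivity
  have hy2 := hy.const_mul m⁻¹
  simp only [mul_zero] at hy2
  refine squeeze_zero (fun n => mul_nonneg zero_le_one (Nm_nonneg hab n)) (fun n => ?_) hy2
  have hbp : ∀ x, 0 ≤ bp (a / 2) ((b + β) / 2) x := fun x => by unfold bp; positivity
  have i2 : IntervalIntegrable (fun x => bp (a / 2) ((b + β) / 2) x * ‖(lam n : ℂ) ^ j * f n x‖ ^ 2)
      volume (a / 2) ((b + β) / 2) := by
    apply ContinuousOn.intervalIntegrable; rw [uIcc_of_le ab0.le]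
    exact (bp_cont _ _).continuousOn.mul ((continuousOn_const.mul ((cf n).mono S)).norm.pow 2)
  have i3 : IntervalIntegrable (fun x => bp (a / 2) ((b + β) / 2) x * ‖(lam n : ℂ) ^ j * f n x‖ ^ 2)
      volume a b := by
    apply i2.mono_set
    rw [uIcc_of_le hab.le, uIcc_of_le ab0.le]
    exact Icc_subset_Icc (by linarith) (by linarith)
  have s1 : (∫ x in a..b, bp (a / 2) ((b + β) / 2) x * ‖(lam n : ℂ) ^ j * f n x‖ ^ 2) ≤
      ∫ x in (a / 2)..((b + β) / 2), bp (a / 2) ((b + β) / 2) x * ‖(lam n : ℂ) ^ j * f n x‖ ^ 2 := by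
    apply intervalIntegral.integral_mono_interval (by linarith) hab.le (by linarith) _ i2
    exact Eventually.of_forall fun x => mul_nonneg (hbp x) (by positivity)
  have s2 : (∫ x in a..b, m * ‖(lam n : ℂ) ^ j * f n x‖ ^ 2) ≤
      ∫ x in a..b, bp (a / 2) ((b + β) / 2) x * ‖(lam n : ℂ) ^ j * f n x‖ ^ 2 := by
    apply intervalIntegral.integral_mono_on hab.le _ i3
    · intro x hx
      have : m ≤ bp (a / 2) ((b + β) / 2) x := by
        unfold bp
        have h1 : a / 2 ≤ x - a / 2 := by linarith [hx.1]
        have h2 : (β - b) / 2 ≤ (b + β) / 2 - x := by linarith [hx.2]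
        have h3 : 0 ≤ (β - b) / 2 := by linarith
        rw [hm]
        gcongr
      gcongr
    · exact (Ct.ii (f := fun n x => (lam n : ℂ) ^ j * f n x)
        (fun n => continuousOn_const.mul (cf n)) ha hab hb n).const_mul m
  rw [intervalIntegral.integral_const_mul] at s2
  have s3 : Nm lam j f a b n = ∫ x in a..b, ‖(lam n : ℂ) ^ j * f n x‖ ^ 2 := by
    unfold Nm
    simp only [norm_mul, mul_pow, intervalIntegral.integral_const_mul, norm_pow, Complex.norm_real,
      Real.norm_eq_abs, zpow_natCast]
  rw [s3, one_mul, le_inv_mul_iff₀ m0]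
  exact s2.trans s1


lemma Sm_zero : Sm lam β 0 (fun _ _ => 0) :=
  ⟨fun _ => continuousOn_const, fun a b _ _ _ => by simp [Nm]⟩

/-- Local data of the reduced second-order system on `(0, β)`. -/
structure Loc (lam : ℕ → ℝ) (β ρ₁ ρ₂ k₁ k₂ k₃ l a₀ : ℝ)
    (u u1 u2 w w1 w2 z z1 z2 R2 R4 R6 : ℕ → ℝ → ℂ) : Prop where
  hl : ∀ n, lam n ≠ 0
  hlt : Tendsto (fun n => |lam n|) atTop atTop
  du : ∀ n, ∀ x ∈ Ioo 0 β, HasDerivAt (u n) (u1 n x) x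
  du1 : ∀ n, ∀ x ∈ Ioo 0 β, HasDerivAt (u1 n) (u2 n x) x
  dw : ∀ n, ∀ x ∈ Ioo 0 β, HasDerivAt (w n) (w1 n x) x
  dw1 : ∀ n, ∀ x ∈ Ioo 0 β, HasDerivAt (w1 n) (w2 n x) x
  dz : ∀ n, ∀ x ∈ Ioo 0 β, HasDerivAt (z n) (z1 n x) x
  dz1 : ∀ n, ∀ x ∈ Ioo 0 β, HasDerivAt (z1 n) (z2 n x) x
  A : ∀ n, ∀ x ∈ Ioo 0 β, (k₁ : ℂ) * u2 n x + ρ₁ * lam n ^ 2 * u n x + k₁ * w1 n x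
      + l * (k₁ + k₃) * z1 n x - l ^ 2 * k₃ * u n x - R2 n x = 0
  B : ∀ n, ∀ x ∈ Ioo 0 β, (k₂ : ℂ) * w2 n x + ρ₂ * lam n ^ 2 * w n x
      - k₁ * (u1 n x + w n x + l * z n x) - R4 n x = 0
  C : ∀ n, ∀ x ∈ Ioo 0 β, (k₃ : ℂ) * z2 n x + ρ₁ * lam n ^ 2 * z n x - l * (k₁ + k₃) * u1 n x
      - l * k₁ * w n x - l ^ 2 * k₁ * z n x - Complex.I * lam n * a₀ * z n x - R6 n x = 0
  hz : Sm lam β 3 z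
  hu : Bd lam β 1 u
  hw : Bd lam β 1 w
  hu1 : Bd lam β 0 u1
  hw1 : Bd lam β 0 w1
  hz1 : Bd lam β 0 z1
  hR2 : Sm lam β 1 R2
  hR4 : Sm lam β 1 R4
  hR6 : Sm lam β 1 R6

section chain
variable {ρ₁ ρ₂ k₁ k₂ k₃ l a₀ : ℝ} {u u1 u2 w w1 w2 z z1 z2 R2 R4 R6 : ℕ → ℝ → ℂ}

lemma bp_a (a b : ℝ) : bp a b a = 0 := by simp [bp]
lemma bp_b (a b : ℝ) : bp a b b = 0 := by simp [bp]
lemma bp1_a (a b : ℝ) : bp1 a b a = 0 := by simp [bp1]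
lemma bp1_b (a b : ℝ) : bp1 a b b = 0 := by simp [bp1]

lemma Loc.gC (D : Loc lam β ρ₁ ρ₂ k₁ k₂ k₃ l a₀ u u1 u2 w w1 w2 z z1 z2 R2 R4 R6)
    {i : ℤ} (hi : i ≤ 1) (hw : Sm lam β i w) :
    Sm lam β i (fun n x => ρ₁ * lam n ^ 2 * z n x
      - l * k₁ * w n x - l ^ 2 * k₁ * z n x - Complex.I * lam n * a₀ * z n x - R6 n x) := by
  have t1 := (((D.hz.pow D.hl 2).mono D.hlt (i := i) (by push_cast; omega)).smul (ρ₁ : ℂ))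
  have t2 := hw.smul (-(l * k₁ : ℂ))
  have t3 := (D.hz.mono D.hlt (i := i) (by omega)).smul (-(l ^ 2 * k₁ : ℂ))
  have t4 := ((D.hz.pow D.hl 1).mono D.hlt (i := i) (by push_cast; omega)).smul (-(Complex.I * a₀))
  have t5 := (D.hR6.mono D.hlt (i := i) hi).smul (-1)
  refine ((((t1.add t2).add t3).add t4).add t5).congr fun n x _ => ?_
  ring

lemma Loc.hu2 (hk1 : 0 < k₁) (D : Loc lam β ρ₁ ρ₂ k₁ k₂ k₃ l a₀ u u1 u2 w w1 w2 z z1 z2 R2 R4 R6) :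
    Bd lam β (-1) u2 := by
  have t1 := ((D.hu.pow D.hl 2).mono D.hlt (i := -1) (by norm_num)).smul (-ρ₁ / k₁ : ℂ)
  have t2 := (D.hw1.mono D.hlt (i := -1) (by norm_num)).smul (-1)
  have t3 := (D.hz1.mono D.hlt (i := -1) (by norm_num)).smul (-(l * (k₁ + k₃) / k₁) : ℂ)
  have t4 := (D.hu.mono D.hlt (i := -1) (by norm_num)).smul (l ^ 2 * k₃ / k₁ : ℂ)
  have t5 := (D.hR2.bd.mono D.hlt (i := -1) (by norm_num)).smul (1 / k₁ : ℂ)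
  have h0 : (k₁ : ℂ) ≠ 0 := by exact_mod_cast hk1.ne'
  refine ((((t1.add t2).add t3).add t4).add t5).congr fun n x hx => ?_
  have := D.A n x hx
  field_simp
  linear_combination this

lemma Loc.hw2 (hk2 : 0 < k₂) (D : Loc lam β ρ₁ ρ₂ k₁ k₂ k₃ l a₀ u u1 u2 w w1 w2 z z1 z2 R2 R4 R6) :
    Bd lam β (-1) w2 := by
  have t1 := ((D.hw.pow D.hl 2).mono D.hlt (i := -1) (by norm_num)).smul (-ρ₂ / k₂ : ℂ)
  have t2 := (D.hu1.mono D.hlt (i := -1) (by norm_num)).smul (k₁ / k₂ : ℂ)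
  have t3 := (D.hw.mono D.hlt (i := -1) (by norm_num)).smul (k₁ / k₂ : ℂ)
  have t4 := (D.hz.bd.mono D.hlt (i := -1) (by norm_num)).smul (k₁ * l / k₂ : ℂ)
  have t5 := (D.hR4.bd.mono D.hlt (i := -1) (by norm_num)).smul (1 / k₂ : ℂ)
  have h0 : (k₂ : ℂ) ≠ 0 := by exact_mod_cast hk2.ne'
  refine ((((t1.add t2).add t3).add t4).add t5).congr fun n x hx => ?_
  have := D.B n x hx
  field_simp
  linear_combination this

lemma Loc.hz2 (hk3 : 0 < k₃) (D : Loc lam β ρ₁ ρ₂ k₁ k₂ k₃ l a₀ u u1 u2 w w1 w2 z z1 z2 R2 R4 R6) :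
    Bd lam β 0 z2 := by
  have t1 := (D.gC (by norm_num) (D.hw.sm D.hl D.hlt (i := 0) (by norm_num))).bd.smul (-(1 / k₃) : ℂ)
  have t2 := D.hu1.smul (l * (k₁ + k₃) / k₃ : ℂ)
  have h0 : (k₃ : ℂ) ≠ 0 := by exact_mod_cast hk3.ne'
  refine (t1.add t2).congr fun n x hx => ?_
  have := D.C n x hx
  field_simp
  linear_combination this

lemma Loc.s1 (hk3 : 0 < k₃) (D : Loc lam β ρ₁ ρ₂ k₁ k₂ k₃ l a₀ u u1 u2 w w1 w2 z z1 z2 R2 R4 R6) :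
    Sm lam β 1 z1 := by
  refine Sm_of_young (j := 1) (K := 1) one_pos D.hz1.1 Sm_zero fun a b ha hab hb => ?_
  have t1 := Zr.ibp (lam := lam) ha hab hb (bp_der a b) (bp1_cont a b) (bp_a a b) (bp_b a b)
    D.dz D.dz1 D.hz1.1 (D.hz2 hk3).1 2
  have t2 := Zr.SB D.hl D.hlt ha hab hb D.hz (D.hz2 hk3) 2 (by norm_num) (bp a b) (bp_cont a b)
  have t3 := Zr.SB D.hl D.hlt ha hab hb D.hz D.hz1 2 (by norm_num) (bp1 a b) (bp1_cont a b)
  refine ((t1.add hab (t2.smul (-1))).add hab (t3.smul (-1))).congr hab fun n x hx => ?_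
  push_cast
  ring

lemma Loc.s2 (hk1 : 0 < k₁) (hk3 : 0 < k₃) (hl0 : 0 < l)
    (D : Loc lam β ρ₁ ρ₂ k₁ k₂ k₃ l a₀ u u1 u2 w w1 w2 z z1 z2 R2 R4 R6) :
    Sm lam β 0 u1 := by
  have hz1 := D.s1 hk3
  refine Sm_of_young (j := 0) (K := l * (k₁ + k₃)) (by positivity) D.hu1.1
    (D.gC (by norm_num) (D.hw.sm D.hl D.hlt (i := 0) (by norm_num))) fun a b ha hab hb => ?_
  have t1 := Zr.ibp (lam := lam) ha hab hb (bp_der a b) (bp1_cont a b) (bp_a a b) (bp_b a b)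
    D.dz1 D.du1 (D.hz2 hk3).1 (D.hu2 hk1).1 0
  have t2 := Zr.SB D.hl D.hlt ha hab hb hz1 (D.hu2 hk1) 0 (by norm_num) (bp a b) (bp_cont a b)
  have t3 := Zr.SB D.hl D.hlt ha hab hb hz1 D.hu1 0 (by norm_num) (bp1 a b) (bp1_cont a b)
  refine (((t1.add hab (t2.smul (-1))).add hab (t3.smul (-1))).smul k₃).congr hab fun n x hx => ?_
  have hC := D.C n x (sub_Icc ha hb hx)
  push_cast
  linear_combination (-(bp a b x : ℂ) * conj (u1 n x)) * hC

lemma Loc.s2b (hr1 : 0 < ρ₁) (hk1 : 0 < k₁) (hk3 : 0 < k₃) (hl0 : 0 < l)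
    (D : Loc lam β ρ₁ ρ₂ k₁ k₂ k₃ l a₀ u u1 u2 w w1 w2 z z1 z2 R2 R4 R6) :
    Sm lam β 1 u := by
  have hu1 := D.s2 hk1 hk3 hl0
  have hu := D.hu.sm D.hl D.hlt (i := 0) (by norm_num)
  refine Sm_of_young (j := 1) (K := ρ₁) hr1 D.hu.1 Sm_zero fun a b ha hab hb => ?_
  have t1 := Zr.ibp (lam := lam) ha hab hb (bp_der a b) (bp1_cont a b) (bp_a a b) (bp_b a b)
    D.du1 D.du (D.hu2 hk1).1 D.hu1.1 0
  have t2 := Zr.SB D.hl D.hlt ha hab hb hu1 hu1.bd 0 (by norm_num) (bp a b) (bp_cont a b)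
  have t3 := Zr.SB D.hl D.hlt ha hab hb hu1 hu.bd 0 (by norm_num) (bp1 a b) (bp1_cont a b)
  have t4 := Zr.BS D.hl D.hlt ha hab hb D.hw1 hu 0 (by norm_num) (bp a b) (bp_cont a b)
  have t5 := Zr.BS D.hl D.hlt ha hab hb D.hz1 hu 0 (by norm_num) (bp a b) (bp_cont a b)
  have t6 := Zr.BS D.hl D.hlt ha hab hb hu.bd hu 0 (by norm_num) (bp a b) (bp_cont a b)
  have t7 := Zr.BS D.hl D.hlt ha hab hb D.hR2.bd hu 0 (by norm_num) (bp a b) (bp_cont a b)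
  have T1 := ((t1.add hab (t2.smul (-1))).add hab (t3.smul (-1))).smul (-k₁)
  have T2 := ((t4.smul (-k₁)).add hab (t5.smul (-(l * (k₁ + k₃))))).add hab
    ((t6.smul (l ^ 2 * k₃)).add hab t7)
  refine (T1.add hab T2).congr hab fun n x hx => ?_
  have hA := D.A n x (sub_Icc ha hb hx)
  push_cast
  linear_combination ((bp a b x : ℂ) * conj (u n x)) * hA

lemma Loc.cB (D : Loc lam β ρ₁ ρ₂ k₁ k₂ k₃ l a₀ u u1 u2 w w1 w2 z z1 z2 R2 R4 R6) (n : ℕ) {x : ℝ}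
    (hx : x ∈ Ioo 0 β) : (k₂ : ℂ) * conj (w2 n x) + ρ₂ * lam n ^ 2 * conj (w n x)
      - k₁ * (conj (u1 n x) + conj (w n x) + l * conj (z n x)) - conj (R4 n x) = 0 := by
  have := congrArg conj (D.B n x hx)
  simpa only [map_add, map_sub, map_mul, map_pow, Complex.conj_ofReal, map_zero] using this

lemma Loc.cA (D : Loc lam β ρ₁ ρ₂ k₁ k₂ k₃ l a₀ u u1 u2 w w1 w2 z z1 z2 R2 R4 R6) (n : ℕ) {x : ℝ}
    (hx : x ∈ Ioo 0 β) : (k₁ : ℂ) * conj (u2 n x) + ρ₁ * lam n ^ 2 * conj (u n x)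
      + k₁ * conj (w1 n x) + l * (k₁ + k₃) * conj (z1 n x) - l ^ 2 * k₃ * conj (u n x)
      - conj (R2 n x) = 0 := by
  have := congrArg conj (D.A n x hx)
  simpa only [map_add, map_sub, map_mul, map_pow, Complex.conj_ofReal, map_zero] using this

lemma Loc.s3 (hr1 : 0 < ρ₁) (hr2 : 0 < ρ₂) (hk1 : 0 < k₁) (hk2 : 0 < k₂) (hk3 : 0 < k₃)
    (hl0 : 0 < l) (D : Loc lam β ρ₁ ρ₂ k₁ k₂ k₃ l a₀ u u1 u2 w w1 w2 z z1 z2 R2 R4 R6) :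
    Sm lam β 1 w := by
  have hz1 := D.s1 hk3
  have hu1 := D.s2 hk1 hk3 hl0
  have hu := D.s2b hr1 hk1 hk3 hl0
  have hu2 := D.hu2 hk1
  have hw2 := D.hw2 hk2
  have hz2 := D.hz2 hk3
  have hw := D.hw.sm D.hl D.hlt (i := 0) (by norm_num)
  refine Sm_of_young (j := 1) (K := l * k₁ * (k₂ * ρ₁ + k₃ * ρ₂)) (by positivity) D.hw.1 Sm_zero
    fun a b ha hab hb => ?_
  have cp := bp_cont a b
  have cp1 := bp1_cont a b
  have I := @Zr.ibp lam β a b ha hab hb _ _ (bp_der a b) cp1 (bp_a a b) (bp_b a b)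
  have t1 := I D.du1 D.dw1 hu2.1 hw2.1 0
  have t2 := Zr.SB D.hl D.hlt ha hab hb hu1 D.hw1 0 (by norm_num) (bp1 a b) cp1
  have t3 := Zr.SB D.hl D.hlt ha hab hb hu1 D.hu1 0 (by norm_num) (bp a b) cp
  have t4 := Zr.SB D.hl D.hlt ha hab hb hu1 D.hw 0 (by norm_num) (bp a b) cp
  have t5 := Zr.SB D.hl D.hlt ha hab hb hu1 D.hz.bd 0 (by norm_num) (bp a b) cp
  have t6 := Zr.SB D.hl D.hlt ha hab hb hu1 D.hR4.bd 0 (by norm_num) (bp a b) cp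
  have t7 := I D.du D.dw D.hu1.1 D.hw1.1 2
  have t8 := Zr.SB D.hl D.hlt ha hab hb hu D.hw 2 (by norm_num) (bp1 a b) cp1
  have t9 := I D.dw D.dw1 D.hw1.1 hw2.1 0
  have t10 := Zr.SB D.hl D.hlt ha hab hb hw D.hw1 0 (by norm_num) (bp1 a b) cp1
  have t11 := Zr.SB D.hl D.hlt ha hab hb hw D.hu1 0 (by norm_num) (bp a b) cp
  have t12 := Zr.SB D.hl D.hlt ha hab hb hw D.hw 0 (by norm_num) (bp a b) cp
  have t13 := Zr.SB D.hl D.hlt ha hab hb hw D.hz.bd 0 (by norm_num) (bp a b) cp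
  have t14 := Zr.SB D.hl D.hlt ha hab hb hw D.hR4.bd 0 (by norm_num) (bp a b) cp
  have t15 := Zr.SB D.hl D.hlt ha hab hb hz1 D.hw1 0 (by norm_num) (bp a b) cp
  have t16 := Zr.SB D.hl D.hlt ha hab hb hu D.hw1 0 (by norm_num) (bp a b) cp
  have t17 := Zr.SB D.hl D.hlt ha hab hb D.hR2 D.hw1 0 (by norm_num) (bp a b) cp
  have t18 := I D.dz1 D.dw hz2.1 D.hw1.1 2
  have t19 := I D.dz D.dw1 D.hz1.1 hw2.1 2
  have t20 := Zr.SB D.hl D.hlt ha hab hb D.hz hw2 2 (by norm_num) (bp a b) cp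
  have t21 := Zr.SB D.hl D.hlt ha hab hb D.hz D.hw1 2 (by norm_num) (bp1 a b) cp1
  have t22 := Zr.SB D.hl D.hlt ha hab hb hz1 D.hw 2 (by norm_num) (bp1 a b) cp1
  have t23 := Zr.SB D.hl D.hlt ha hab hb D.hz D.hw 4 (by norm_num) (bp a b) cp
  have t24 := Zr.SB D.hl D.hlt ha hab hb D.hz D.hw 2 (by norm_num) (bp a b) cp
  have t25 := Zr.SB D.hl D.hlt ha hab hb D.hz D.hw 3 (by norm_num) (bp a b) cp
  have t26 := Zr.SB D.hl D.hlt ha hab hb D.hR6 D.hw 2 (by norm_num) (bp a b) cp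
  have T1 := ((t1.smul (k₁ * k₂)).add hab (t2.smul (-(k₁ * k₂)))).add hab
    (((((t3.add hab t4).add hab (t5.smul l)).smul k₁).add hab t6).smul (-k₁))
  have T2 := (t7.add hab (t8.smul (-1))).smul (k₂ * ρ₁)
  have T3 := ((t9.smul (k₁ * k₂)).add hab (t10.smul (-(k₁ * k₂)))).add hab
    (((((t11.add hab t12).add hab (t13.smul l)).smul k₁).add hab t14).smul (-k₁))
  have T4 := ((t15.smul (k₂ * (l * (k₁ + k₃)))).add hab (t16.smul (-(k₂ * l ^ 2 * k₃)))).add hab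
    (t17.smul (-k₂))
  have T := ((T1.add hab T2).add hab (T3.add hab T4)).smul (-(l * (k₁ + k₃)))
  have V1 := (((t18.add hab (t19.smul (-1))).add hab (t20.add hab t21)).add hab
    (t22.smul (-1))).smul k₃
  have V2 := ((t23.smul ρ₁).add hab (t24.smul (-(l ^ 2 * k₁)))).add hab
    ((t25.smul (-(Complex.I * a₀))).add hab (t26.smul (-1)))
  have V := (V1.add hab V2).smul (-(k₁ * ρ₂ - k₂ * ρ₁))
  refine (T.add hab V).congr hab fun n x hx => ?_
  have hA := D.A n x (sub_Icc ha hb hx)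
  have hB := D.cB n (sub_Icc ha hb hx)
  have hC := D.C n x (sub_Icc ha hb hx)
  push_cast
  linear_combination ((bp a b x : ℂ) * conj (w1 n x) * (l * (k₁ + k₃)) * k₂) * hA
    + ((bp a b x : ℂ) * (k₁ * u1 n x + k₁ * w n x) * (l * (k₁ + k₃))) * hB
    + ((k₁ * ρ₂ - k₂ * ρ₁) * lam n ^ 2 * (bp a b x : ℂ) * conj (w n x)) * hC

lemma Loc.s3b (hr1 : 0 < ρ₁) (hr2 : 0 < ρ₂) (hk1 : 0 < k₁) (hk2 : 0 < k₂) (hk3 : 0 < k₃)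
    (hl0 : 0 < l) (D : Loc lam β ρ₁ ρ₂ k₁ k₂ k₃ l a₀ u u1 u2 w w1 w2 z z1 z2 R2 R4 R6) :
    Sm lam β 0 w1 := by
  have hw := D.s3 hr1 hr2 hk1 hk2 hk3 hl0
  have hw2 := D.hw2 hk2
  refine Sm_of_young (j := 0) (K := 1) one_pos D.hw1.1 Sm_zero fun a b ha hab hb => ?_
  have t1 := Zr.ibp (lam := lam) ha hab hb (bp_der a b) (bp1_cont a b) (bp_a a b) (bp_b a b)
    D.dw D.dw1 D.hw1.1 hw2.1 0
  have t2 := Zr.SB D.hl D.hlt ha hab hb hw hw2 0 (by norm_num) (bp a b) (bp_cont a b)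
  have t3 := Zr.SB D.hl D.hlt ha hab hb hw D.hw1 0 (by norm_num) (bp1 a b) (bp1_cont a b)
  refine ((t1.add hab (t2.smul (-1))).add hab (t3.smul (-1))).congr hab fun n x hx => ?_
  push_cast
  ring

lemma Loc.s4 (hr1 : 0 < ρ₁) (hr2 : 0 < ρ₂) (hk1 : 0 < k₁) (hk2 : 0 < k₂) (hk3 : 0 < k₃)
    (hl0 : 0 < l) (D : Loc lam β ρ₁ ρ₂ k₁ k₂ k₃ l a₀ u u1 u2 w w1 w2 z z1 z2 R2 R4 R6) :
    Sm lam β 1 u1 := by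
  have hz1 := D.s1 hk3
  have hu := D.s2b hr1 hk1 hk3 hl0
  have hu2 := D.hu2 hk1
  have hw2 := D.hw2 hk2
  have hz2 := D.hz2 hk3
  have hw := D.s3 hr1 hr2 hk1 hk2 hk3 hl0
  have hg := (((D.gC le_rfl hw).pow D.hl 1).smul k₁).add ((D.hz.pow D.hl 3).smul (-(k₃ * ρ₁)))
  refine Sm_of_young (j := 1) (K := l * (k₁ + k₃) * k₁) (by positivity) D.hu1.1 hg
    fun a b ha hab hb => ?_
  have cp := bp_cont a b
  have cp1 := bp1_cont a b
  have I := @Zr.ibp lam β a b ha hab hb _ _ (bp_der a b) cp1 (bp_a a b) (bp_b a b)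
  have t1 := I D.dz1 D.du1 hz2.1 hu2.1 2
  have t2 := Zr.ibp (lam := lam) ha hab hb (bp1_der a b) (bp2_cont a b) (bp1_a a b) (bp1_b a b)
    D.dz D.du1 D.hz1.1 hu2.1 2
  have t3 := Zr.SB D.hl D.hlt ha hab hb D.hz hu2 2 (by norm_num) (bp1 a b) cp1
  have t4 := Zr.SB D.hl D.hlt ha hab hb D.hz D.hu1 2 (by norm_num) (bp2 a b) (bp2_cont a b)
  have t5 := I D.dz D.du D.hz1.1 D.hu1.1 4
  have t6 := Zr.SB D.hl D.hlt ha hab hb D.hz D.hu 4 (by norm_num) (bp1 a b) cp1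
  have t7 := I D.dz D.dw1 D.hz1.1 hw2.1 2
  have t8 := Zr.SB D.hl D.hlt ha hab hb D.hz hw2 2 (by norm_num) (bp a b) cp
  have t9 := Zr.SB D.hl D.hlt ha hab hb D.hz D.hw1 2 (by norm_num) (bp1 a b) cp1
  have t10 := Zr.SB D.hl D.hlt ha hab hb hz1 hz1.bd 2 (by norm_num) (bp a b) cp
  have t11 := Zr.SB D.hl D.hlt ha hab hb hz1 D.hu 2 (by norm_num) (bp a b) cp
  have t12 := Zr.SB D.hl D.hlt ha hab hb hz1 D.hR2.bd 2 (by norm_num) (bp a b) cp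
  have T1 := (t1.add hab ((t3.add hab t4).add hab (t2.smul (-1)))).smul k₁
  have T2 := (t5.add hab (t6.smul (-1))).smul ρ₁
  have T3 := (t7.add hab ((t8.add hab t9).smul (-1))).smul k₁
  have T4 := ((t10.smul (l * (k₁ + k₃))).add hab (t11.smul (-(l ^ 2 * k₃)))).add hab (t12.smul (-1))
  refine (((T1.add hab T2).add hab (T3.add hab T4)).smul k₃).congr hab fun n x hx => ?_
  have hA := D.cA n (sub_Icc ha hb hx)
  have hC := D.C n x (sub_Icc ha hb hx)
  push_cast
  linear_combination (-(k₁ * (bp a b x : ℂ) * lam n ^ 2 * conj (u1 n x))) * hC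
    - (k₃ * (bp a b x : ℂ) * lam n ^ 2 * z1 n x) * hA

lemma Loc.s5 (hr1 : 0 < ρ₁) (hr2 : 0 < ρ₂) (hk1 : 0 < k₁) (hk2 : 0 < k₂) (hk3 : 0 < k₃)
    (hl0 : 0 < l) (D : Loc lam β ρ₁ ρ₂ k₁ k₂ k₃ l a₀ u u1 u2 w w1 w2 z z1 z2 R2 R4 R6) :
    Sm lam β 2 u := by
  have hz1 := D.s1 hk3
  have hu := D.s2b hr1 hk1 hk3 hl0
  have hu1 := D.s4 hr1 hr2 hk1 hk2 hk3 hl0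
  have hw1 := D.s3b hr1 hr2 hk1 hk2 hk3 hl0
  have hg := ((hw1.smul (-k₁)).add ((hz1.mono D.hlt (i := 0) (by norm_num)).smul
    (-(l * (k₁ + k₃))))).add (((hu.mono D.hlt (i := 0) (by norm_num)).smul (l ^ 2 * k₃)).add
    (D.hR2.mono D.hlt (i := 0) (by norm_num)))
  refine Sm_of_young (j := 2) (K := ρ₁) hr1 D.hu.1 hg fun a b ha hab hb => ?_
  have t1 := Zr.ibp (lam := lam) ha hab hb (bp_der a b) (bp1_cont a b) (bp_a a b) (bp_b a b)
    D.du1 D.du (D.hu2 hk1).1 D.hu1.1 2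
  have t2 := Zr.SB D.hl D.hlt ha hab hb hu1 hu1.bd 2 (by norm_num) (bp a b) (bp_cont a b)
  have t3 := Zr.SB D.hl D.hlt ha hab hb hu1 hu.bd 2 (by norm_num) (bp1 a b) (bp1_cont a b)
  refine ((t1.add hab ((t2.add hab t3).smul (-1))).smul (-k₁)).congr hab fun n x hx => ?_
  have hA := D.A n x (sub_Icc ha hb hx)
  push_cast
  linear_combination ((bp a b x : ℂ) * lam n ^ 2 * conj (u n x)) * hA

end chain

section front

lemma c1d {f : ℝ → ℂ} {a b : ℝ} (hab : a < b) (hf : ContDiffOn ℝ 1 f (Icc a b)) :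
    ContinuousOn (derivWithin f (Icc a b)) (Icc a b) :=
  hf.continuousOn_derivWithin (uniqueDiffOn_Icc hab) le_rfl

lemma c1e {f : ℝ → ℂ} {a b x : ℝ} (hx : x ∈ Ioo a b) : derivWithin f (Icc a b) x = deriv f x :=
  derivWithin_of_mem_nhds (Icc_mem_nhds hx.1 hx.2)

lemma c1h {f : ℝ → ℂ} {a b x : ℝ} (hf : ContDiffOn ℝ 1 f (Icc a b)) (hx : x ∈ Ioo a b) :
    HasDerivAt f (derivWithin f (Icc a b) x) x := by
  rw [c1e hx]
  exact ((hf.differentiableOn one_ne_zero).differentiableAt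
    (Icc_mem_nhds hx.1 hx.2)).hasDerivAt

lemma c2d {f : ℝ → ℂ} {a b x : ℝ} (hf : ContDiffOn ℝ 2 f (Icc a b)) (hx : x ∈ Ioo a b) :
    DifferentiableAt ℝ (deriv f) x := by
  have h1 : ContDiffOn ℝ 1 (deriv f) (Ioo a b) :=
    (hf.mono Ioo_subset_Icc_self).deriv_of_isOpen isOpen_Ioo (by norm_num)
  exact (h1.differentiableOn one_ne_zero).differentiableAt (Ioo_mem_nhds hx.1 hx.2)

lemma integral_congr_Ioo' {g h : ℝ → ℝ} {a b : ℝ} (hab : a ≤ b) (H : ∀ x ∈ Ioo a b, g x = h x) :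
    (∫ x in a..b, g x) = ∫ x in a..b, h x := by
  rw [intervalIntegral.integral_of_le hab, intervalIntegral.integral_of_le hab,
    integral_Ioc_eq_integral_Ioo, integral_Ioc_eq_integral_Ioo]
  exact setIntegral_congr_fun measurableSet_Ioo H

lemma ii_cont {g : ℝ → ℝ} {a b : ℝ} (hab : a ≤ b) (hg : ContinuousOn g (Icc a b)) :
    IntervalIntegrable g volume a b := by
  apply ContinuousOn.intervalIntegrable
  rwa [uIcc_of_le hab]

/-- energy density -/
def en (r1 r2 k1 k2 k3 : ℝ) (a1 a2 a3 b2 b4 b6 : ℝ → ℂ) (x : ℝ) : ℝ :=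
  k1 * ‖a1 x‖ ^ 2 + r1 * ‖b2 x‖ ^ 2 + k2 * ‖a2 x‖ ^ 2 + r2 * ‖b4 x‖ ^ 2
    + k3 * ‖a3 x‖ ^ 2 + r1 * ‖b6 x‖ ^ 2

lemma en_cont {r1 r2 k1 k2 k3 : ℝ} {a1 a2 a3 b2 b4 b6 : ℝ → ℂ} {s : Set ℝ}
    (h1 : ContinuousOn a1 s) (h2 : ContinuousOn a2 s) (h3 : ContinuousOn a3 s)
    (h4 : ContinuousOn b2 s) (h5 : ContinuousOn b4 s) (h6 : ContinuousOn b6 s) :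
    ContinuousOn (en r1 r2 k1 k2 k3 a1 a2 a3 b2 b4 b6) s := by
  unfold en
  fun_prop

lemma yng {k δ : ℝ} (hk : 0 < k) (hδ : 0 < δ) (z w : ℂ) :
    k * (z * conj w).re ≤ (δ * (k * ‖w‖ ^ 2) + δ⁻¹ * (k * ‖z‖ ^ 2)) / 2 := by
  have h1 : (z * conj w).re ≤ ‖z‖ * ‖w‖ := by
    have := Complex.re_le_norm (z * conj w)
    simpa using this
  have h2 : ‖z‖ * ‖w‖ ≤ (δ * ‖w‖ ^ 2 + δ⁻¹ * ‖z‖ ^ 2) / 2 := by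
    have h3 : δ * δ⁻¹ = 1 := mul_inv_cancel₀ hδ.ne'
    have h4 : 0 < δ⁻¹ := inv_pos.2 hδ
    have h5 : δ * ‖w‖ ^ 2 + δ⁻¹ * ‖z‖ ^ 2 - 2 * (‖z‖ * ‖w‖) = δ⁻¹ * (δ * ‖w‖ - ‖z‖) ^ 2 := by
      field_simp
      ring
    have : 0 ≤ δ⁻¹ * (δ * ‖w‖ - ‖z‖) ^ 2 := by positivity
    linarith
  have := mul_le_mul_of_nonneg_left (h1.trans h2) hk.le
  linarith

lemma seg {ρ₁ ρ₂ k₁ k₂ k₃ l lm c a δ α γ : ℝ} (hr1 : 0 < ρ₁) (hr2 : 0 < ρ₂) (hk1 : 0 < k₁)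
    (hk2 : 0 < k₂) (hk3 : 0 < k₃) (hc : 0 ≤ c) (hδ : 0 < δ) (hab : α ≤ γ)
    {s1 s2 s3 v2 v4 v6 p1 p2 p3 f2 f4 f6 : ℝ → ℂ}
    (cs1 : ContinuousOn s1 (Icc α γ)) (cs2 : ContinuousOn s2 (Icc α γ))
    (cs3 : ContinuousOn s3 (Icc α γ)) (cv2 : ContinuousOn v2 (Icc α γ))
    (cv4 : ContinuousOn v4 (Icc α γ)) (cv6 : ContinuousOn v6 (Icc α γ))
    (cp1 : ContinuousOn p1 (Icc α γ)) (cp2 : ContinuousOn p2 (Icc α γ))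
    (cp3 : ContinuousOn p3 (Icc α γ)) (cf2 : ContinuousOn f2 (Icc α γ))
    (cf4 : ContinuousOn f4 (Icc α γ)) (cf6 : ContinuousOn f6 (Icc α γ))
    (d1 : ∀ x ∈ Ioo α γ, HasDerivAt (fun y => (k₁ : ℂ) * s1 y)
      (Complex.I * lm * ρ₁ * v2 x - l * k₃ * s3 x - ρ₁ * c * f2 x) x)
    (d2 : ∀ x ∈ Ioo α γ, HasDerivAt (fun y => (k₂ : ℂ) * s2 y)
      (Complex.I * lm * ρ₂ * v4 x + k₁ * s1 x - ρ₂ * c * f4 x) x)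
    (d3 : ∀ x ∈ Ioo α γ, HasDerivAt (fun y => (k₃ : ℂ) * s3 y)
      (Complex.I * lm * ρ₁ * v6 x + l * k₁ * s1 x + a * v6 x - ρ₁ * c * f6 x) x)
    (e2 : ∀ x ∈ Ioo α γ, HasDerivAt v2 (Complex.I * lm * s1 x - v4 x - l * v6 x - c * p1 x) x)
    (e4 : ∀ x ∈ Ioo α γ, HasDerivAt v4 (Complex.I * lm * s2 x - c * p2 x) x)
    (e6 : ∀ x ∈ Ioo α γ, HasDerivAt v6 (Complex.I * lm * s3 x + l * v2 x - c * p3 x) x) :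
    a * (∫ x in α..γ, ‖v6 x‖ ^ 2) ≤
      (k₁ * s1 γ * conj (v2 γ) + k₂ * s2 γ * conj (v4 γ) + k₃ * s3 γ * conj (v6 γ)).re
      - (k₁ * s1 α * conj (v2 α) + k₂ * s2 α * conj (v4 α) + k₃ * s3 α * conj (v6 α)).re
      + c * ((δ * (∫ x in α..γ, en ρ₁ ρ₂ k₁ k₂ k₃ s1 s2 s3 v2 v4 v6 x)
        + δ⁻¹ * (∫ x in α..γ, en ρ₁ ρ₂ k₁ k₂ k₃ p1 p2 p3 f2 f4 f6 x)) / 2) := by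
  have ceu := en_cont (r1 := ρ₁) (r2 := ρ₂) (k1 := k₁) (k2 := k₂) (k3 := k₃) cs1 cs2 cs3 cv2 cv4 cv6
  have cef := en_cont (r1 := ρ₁) (r2 := ρ₂) (k1 := k₁) (k2 := k₂) (k3 := k₃) cp1 cp2 cp3 cf2 cf4 cf6
  let G : ℝ → ℝ := fun x => ρ₁ * (f2 x * conj (v2 x)).re + ρ₂ * (f4 x * conj (v4 x)).re
    + ρ₁ * (f6 x * conj (v6 x)).re + k₁ * (p1 x * conj (s1 x)).re + k₂ * (p2 x * conj (s2 x)).re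
    + k₃ * (p3 x * conj (s3 x)).re
  have cc : ∀ {f : ℝ → ℂ}, ContinuousOn f (Icc α γ) →
      ContinuousOn (fun x => conj (f x)) (Icc α γ) :=
    fun h => Complex.continuous_conj.comp_continuousOn h
  have cr : ∀ {f : ℝ → ℂ}, ContinuousOn f (Icc α γ) →
      ContinuousOn (fun x => (f x).re) (Icc α γ) :=
    fun h => Complex.continuous_re.comp_continuousOn h
  have cG : ContinuousOn G (Icc α γ) := by
    have t1 := cr (cf2.mul (cc cv2))
    have t2 := cr (cf4.mul (cc cv4))
    have t3 := cr (cf6.mul (cc cv6))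
    have t4 := cr (cp1.mul (cc cs1))
    have t5 := cr (cp2.mul (cc cs2))
    have t6 := cr (cp3.mul (cc cs3))
    exact ((((((t1.const_mul ρ₁).add (t2.const_mul ρ₂)).add (t3.const_mul ρ₁)).add
      (t4.const_mul k₁)).add (t5.const_mul k₂)).add (t6.const_mul k₃))
  have cv : ContinuousOn (fun x => ‖v6 x‖ ^ 2) (Icc α γ) := cv6.norm.pow 2
  let P : ℝ → ℂ := fun x => k₁ * s1 x * conj (v2 x) + k₂ * s2 x * conj (v4 x)
    + k₃ * s3 x * conj (v6 x)
  have cP : ContinuousOn (fun x => (P x).re) (Icc α γ) := by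
    apply cr
    exact (((cs1.const_mul _).mul (cc cv2)).add ((cs2.const_mul _).mul (cc cv4))).add
      ((cs3.const_mul _).mul (cc cv6))
  have hP : ∀ x ∈ Ioo α γ, HasDerivAt (fun x => (P x).re) (a * ‖v6 x‖ ^ 2 - c * G x) x := by
    intro x hx
    have h := (((d1 x hx).mul (e2 x hx).star).add ((d2 x hx).mul (e4 x hx).star)).add
      ((d3 x hx).mul (e6 x hx).star)
    have h' := (Complex.reCLM.hasFDerivAt.comp_hasDerivAt x h)
    refine h'.congr_deriv ?_
    simp only [Complex.reCLM_apply, G]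
    rw [← Complex.normSq_eq_norm_sq]
    simp [Complex.normSq_apply]
    ring
  have hF := intervalIntegral.integral_eq_sub_of_hasDerivAt_of_le hab cP hP
    (ii_cont hab ((cv.const_mul a).sub (cG.const_mul c)))
  rw [intervalIntegral.integral_sub (ii_cont hab (cv.const_mul a)) (ii_cont hab (cG.const_mul c)),
    intervalIntegral.integral_const_mul, intervalIntegral.integral_const_mul] at hF
  have hG : (∫ x in α..γ, G x) ≤ (δ * (∫ x in α..γ, en ρ₁ ρ₂ k₁ k₂ k₃ s1 s2 s3 v2 v4 v6 x)
        + δ⁻¹ * (∫ x in α..γ, en ρ₁ ρ₂ k₁ k₂ k₃ p1 p2 p3 f2 f4 f6 x)) / 2 := by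
    have cE : ContinuousOn (fun x => (δ * en ρ₁ ρ₂ k₁ k₂ k₃ s1 s2 s3 v2 v4 v6 x
        + δ⁻¹ * en ρ₁ ρ₂ k₁ k₂ k₃ p1 p2 p3 f2 f4 f6 x) / 2) (Icc α γ) :=
      ((ceu.const_mul δ).add (cef.const_mul δ⁻¹)).div_const 2
    have := intervalIntegral.integral_mono_on hab (ii_cont hab cG)
      (ii_cont hab cE) (fun x _ => by
        have t1 := yng hr1 hδ (f2 x) (v2 x)
        have t2 := yng hr2 hδ (f4 x) (v4 x)
        have t3 := yng hr1 hδ (f6 x) (v6 x)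
        have t4 := yng hk1 hδ (p1 x) (s1 x)
        have t5 := yng hk2 hδ (p2 x) (s2 x)
        have t6 := yng hk3 hδ (p3 x) (s3 x)
        simp only [G, en]
        linarith)
    refine this.trans (le_of_eq ?_)
    rw [intervalIntegral.integral_div, intervalIntegral.integral_add
      (ii_cont hab (ceu.const_mul δ)) (ii_cont hab (cef.const_mul δ⁻¹)),
      intervalIntegral.integral_const_mul, intervalIntegral.integral_const_mul]
  have := mul_le_mul_of_nonneg_left hG hc
  simp only [P] at hF
  linarith

lemma ptw {f1 f3 f5 p1 p2 p3 : ℝ → ℂ} {L l : ℝ} (hL : 0 < L)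
    (c1 : ContinuousOn f1 (Icc 0 L)) (c3 : ContinuousOn f3 (Icc 0 L))
    (c5 : ContinuousOn f5 (Icc 0 L)) (cp1 : ContinuousOn p1 (Icc 0 L))
    (cp2 : ContinuousOn p2 (Icc 0 L)) (cp3 : ContinuousOn p3 (Icc 0 L))
    (d1 : ∀ x ∈ Ioo 0 L, HasDerivAt f1 (p1 x - f3 x - l * f5 x) x)
    (d3 : ∀ x ∈ Ioo 0 L, HasDerivAt f3 (p2 x) x)
    (d5 : ∀ x ∈ Ioo 0 L, HasDerivAt f5 (p3 x + l * f1 x) x)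
    (h1 : f1 0 = 0) (h3 : f3 0 = 0) (h5 : f5 0 = 0) {x : ℝ} (hx : x ∈ Icc 0 L) :
    ‖f1 x‖ ^ 2 + ‖f3 x‖ ^ 2 + ‖f5 x‖ ^ 2 ≤
      Real.exp (2 * L) * ∫ y in (0 : ℝ)..L, (‖p1 y‖ ^ 2 + ‖p2 y‖ ^ 2 + ‖p3 y‖ ^ 2) := by
  let Q : ℝ → ℝ := fun y => ‖f1 y‖ ^ 2 + ‖f3 y‖ ^ 2 + ‖f5 y‖ ^ 2
  let G : ℝ → ℝ := fun y => ‖p1 y‖ ^ 2 + ‖p2 y‖ ^ 2 + ‖p3 y‖ ^ 2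
  let Q1 : ℝ → ℝ := fun y => 2 * inner ℝ (f1 y) (p1 y - f3 y - l * f5 y) +
    2 * inner ℝ (f3 y) (p2 y) + 2 * inner ℝ (f5 y) (p3 y + l * f1 y)
  have cQ : ContinuousOn Q (Icc 0 L) := ((c1.norm.pow 2).add (c3.norm.pow 2)).add (c5.norm.pow 2)
  have cG : ContinuousOn G (Icc 0 L) := ((cp1.norm.pow 2).add (cp2.norm.pow 2)).add (cp3.norm.pow 2)
  have cQ1 : ContinuousOn Q1 (Icc 0 L) := by
    refine ((ContinuousOn.const_mul (c1.inner (𝕜 := ℝ) ((cp1.sub c3).sub (c5.const_mul _))) 2).add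
      (ContinuousOn.const_mul (c3.inner (𝕜 := ℝ) cp2) 2)).add
      (ContinuousOn.const_mul (c5.inner (𝕜 := ℝ) (cp3.add (c1.const_mul _))) 2)
  have ce : Continuous (fun y : ℝ => Real.exp (-2 * y)) := by fun_prop
  have dQ : ∀ y ∈ Ioo 0 L, HasDerivAt (fun y => Real.exp (-2 * y) * Q y)
      (Real.exp (-2 * y) * (Q1 y - 2 * Q y)) y := by
    intro y hy
    have hq := (((d1 y hy).norm_sq).add ((d3 y hy).norm_sq)).add ((d5 y hy).norm_sq)
    have he : HasDerivAt (fun y : ℝ => Real.exp (-2 * y)) (Real.exp (-2 * y) * (-2 * 1)) y :=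
      ((hasDerivAt_id y).const_mul (-2)).exp
    refine (he.mul hq).congr_deriv ?_
    simp only [Q, Q1, Pi.add_apply]
    ring
  have hle : ∀ y ∈ Icc 0 L, Real.exp (-2 * y) * (Q1 y - 2 * Q y) ≤ G y := by
    intro y hy
    have i1 := real_inner_le_norm (f1 y) (p1 y)
    have i2 := neg_le_of_abs_le (abs_real_inner_le_norm (f1 y) (f3 y))
    have i3 := real_inner_le_norm (f3 y) (p2 y)
    have i4 := real_inner_le_norm (f5 y) (p3 y)
    have e1 : Q1 y = 2 * inner ℝ (f1 y) (p1 y) - 2 * inner ℝ (f1 y) (f3 y)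
        + 2 * inner ℝ (f3 y) (p2 y) + 2 * inner ℝ (f5 y) (p3 y) := by
      simp only [Q1, ← Complex.real_smul, inner_sub_right, inner_add_right, inner_smul_right]
      rw [real_inner_comm (f1 y) (f5 y)]
      ring
    have hb : Q1 y - 2 * Q y ≤ G y := by
      rw [e1]
      simp only [Q, G]
      nlinarith [sq_nonneg (‖f1 y‖ - ‖p1 y‖), sq_nonneg (‖f1 y‖ - ‖f3 y‖),
        sq_nonneg (‖f3 y‖ - ‖p2 y‖), sq_nonneg (‖f5 y‖ - ‖p3 y‖), sq_nonneg ‖f5 y‖]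
    have hG0 : 0 ≤ G y := by simp only [G]; positivity
    have h0 := Real.exp_pos (-2 * y)
    have h1 : Real.exp (-2 * y) ≤ 1 := Real.exp_le_one_iff.2 (by linarith [hy.1])
    nlinarith
  have hsub : Icc 0 x ⊆ Icc 0 L := Icc_subset_Icc_right hx.2
  have hF := intervalIntegral.integral_eq_sub_of_hasDerivAt_of_le hx.1
    ((ce.continuousOn.mul cQ).mono hsub) (fun y hy => dQ y ⟨hy.1, hy.2.trans_le hx.2⟩)
    (ii_cont hx.1 ((ce.continuousOn.mul (cQ1.sub (cQ.const_mul 2))).mono hsub))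
  have h6 := intervalIntegral.integral_mono_on hx.1
    (ii_cont hx.1 ((ce.continuousOn.mul (cQ1.sub (cQ.const_mul 2))).mono hsub))
    (ii_cont hx.1 (cG.mono hsub)) (fun y hy => hle y (hsub hy))
  have h7 : (∫ y in (0 : ℝ)..x, G y) ≤ ∫ y in (0 : ℝ)..L, G y := by
    apply intervalIntegral.integral_mono_interval le_rfl hx.1 hx.2
    · exact Eventually.of_forall fun y => by simp only [G]; positivity
    · exact ii_cont hL.le cG
  have hQ0 : Q 0 = 0 := by simp [Q, h1, h3, h5]
  have hF2 : _ = Real.exp (-2 * x) * Q x - Real.exp (-2 * 0) * Q 0 := hF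
  rw [hQ0, mul_zero, sub_zero] at hF2
  have h8 : Real.exp (-2 * x) * Q x ≤ ∫ y in (0 : ℝ)..L, G y := by
    rw [← hF2]; exact h6.trans h7
  have h9 : 0 ≤ ∫ y in (0 : ℝ)..L, G y :=
    intervalIntegral.integral_nonneg hL.le fun y _ => by simp only [G]; positivity
  have h10 : Q x = Real.exp (2 * x) * (Real.exp (-2 * x) * Q x) := by
    rw [← mul_assoc, ← Real.exp_add]; simp
  have h11 : Real.exp (2 * x) ≤ Real.exp (2 * L) := Real.exp_le_exp.2 (by linarith [hx.2])
  change Q x ≤ Real.exp (2 * L) * ∫ y in (0 : ℝ)..L, G y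
  rw [h10]
  exact (mul_le_mul_of_nonneg_left h8 (Real.exp_pos _).le).trans
    (mul_le_mul_of_nonneg_right h11 h9)

lemma Sm_of_le {j : ℤ} {f : ℕ → ℝ → ℂ} {M : ℕ → ℝ} (hf : Ct β f) (hM : Tendsto M atTop (nhds 0))
    (h : ∀ a b, 0 < a → a < b → b < β → ∀ n, Nm lam j f a b n ≤ M n) : Sm lam β j f := by
  refine ⟨hf, fun a b ha hab hb => ?_⟩
  simp only [one_mul]
  exact squeeze_zero (fun n => Nm_nonneg hab n) (h a b ha hab hb) hM

lemma Bd_of_le {j : ℤ} {f : ℕ → ℝ → ℂ} {M : ℝ} (hf : Ct β f)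
    (h : ∀ a b, 0 < a → a < b → b < β → ∀ n, Nm lam j f a b n ≤ M) : Bd lam β j f := by
  refine ⟨hf, fun a b ha hab hb δ h0 h1 => ?_⟩
  have := h1.mul_const M
  rw [zero_mul] at this
  exact squeeze_zero (fun n => mul_nonneg (h0 n) (Nm_nonneg hab n))
    (fun n => mul_le_mul_of_nonneg_left (h a b ha hab hb n) (h0 n)) this

lemma Nm_inv (hl : ∀ n, lam n ≠ 0) {j : ℤ} {f : ℕ → ℝ → ℂ} (k : ℕ) {a b : ℝ} (n : ℕ) :
    Nm lam (j + k) (fun n x => ((lam n : ℂ) ^ k)⁻¹ * f n x) a b n = Nm lam j f a b n := by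
  unfold Nm
  simp only [norm_mul, mul_pow, intervalIntegral.integral_const_mul, norm_pow, norm_inv,
    Complex.norm_real, Real.norm_eq_abs]
  have : |lam n| ≠ 0 := abs_ne_zero.2 (hl n)
  rw [zpow_add₀ this, zpow_natCast]
  field_simp

lemma Sm.inv (hl : ∀ n, lam n ≠ 0) {j : ℤ} {f : ℕ → ℝ → ℂ} (h : Sm lam β j f) (k : ℕ) :
    Sm lam β (j + k) (fun n x => ((lam n : ℂ) ^ k)⁻¹ * f n x) :=
  ⟨fun n => (h.1 n).const_mul _, fun a b ha hab hb => by
    simpa only [Nm_inv hl k] using h.2 a b ha hab hb⟩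

lemma Bd.inv (hl : ∀ n, lam n ≠ 0) {j : ℤ} {f : ℕ → ℝ → ℂ} (h : Bd lam β j f) (k : ℕ) :
    Bd lam β (j + k) (fun n x => ((lam n : ℂ) ^ k)⁻¹ * f n x) :=
  ⟨fun n => (h.1 n).const_mul _, fun a b ha hab hb δ h0 h1 => by
    simpa only [Nm_inv hl k] using h.2 a b ha hab hb δ h0 h1⟩

/-- local squared norm controlled by a global energy -/
lemma Nm_zero_le {f : ℕ → ℝ → ℂ} {a b k L : ℝ} (hk : 0 < k) (ha : 0 < a) (hab : a < b)
    (hb : b < β) (hβ : β < L) (n : ℕ) (hf : ContinuousOn (f n) (Icc 0 L)) {e : ℝ → ℝ}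
    (he : ContinuousOn e (Icc 0 L)) (hle : ∀ x, k * ‖f n x‖ ^ 2 ≤ e x) :
    Nm lam 0 f a b n ≤ k⁻¹ * ∫ x in (0 : ℝ)..L, e x := by
  have hbL := hb.trans hβ
  have hs : Icc a b ⊆ Icc 0 L := Icc_subset_Icc ha.le hbL.le
  have h1 := intervalIntegral.integral_mono_on hab.le
    (ii_cont hab.le (((hf.norm.pow 2).const_mul k).mono hs)) (ii_cont hab.le (he.mono hs))
    (fun x _ => hle x)
  have h2 : (∫ x in a..b, e x) ≤ ∫ x in (0 : ℝ)..L, e x := by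
    apply intervalIntegral.integral_mono_interval ha.le hab.le hbL.le
    · exact Eventually.of_forall fun y => le_trans (by positivity) (hle y)
    · exact ii_cont (ha.trans (hab.trans hbL)).le he
  have h3 : (∫ x in a..b, (fun x => k * ‖f n x‖ ^ 2) x) = k * ∫ x in a..b, ‖f n x‖ ^ 2 :=
    intervalIntegral.integral_const_mul _ _
  unfold Nm
  simp only [zpow_zero, one_pow, one_mul]
  rw [inv_mul_eq_div, le_div_iff₀ hk]
  have h4 : (∫ x in a..b, k * ‖f n x‖ ^ 2) ≤ ∫ x in (0 : ℝ)..L, e x := h1.trans h2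
  rw [intervalIntegral.integral_const_mul] at h4
  linarith

end front

section assemble

/-- first strain -/
def g1 (l L : ℝ) (a b c : ℝ → ℂ) (x : ℝ) : ℂ := derivWithin a (Icc 0 L) x + b x + (l : ℂ) * c x
/-- second strain -/
def g2 (L : ℝ) (b : ℝ → ℂ) (x : ℝ) : ℂ := derivWithin b (Icc 0 L) x
/-- third strain -/
def g3 (l L : ℝ) (a c : ℝ → ℂ) (x : ℝ) : ℂ := derivWithin c (Icc 0 L) x - (l : ℂ) * a x

variable {ρ₁ ρ₂ k₁ k₂ k₃ l L a₀ : ℝ}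

/-- energy density of the solution -/
def eU (S : BresseSetting ρ₁ ρ₂ k₁ k₂ k₃ l L β a₀ 4) (n : ℕ) : ℝ → ℝ :=
  en ρ₁ ρ₂ k₁ k₂ k₃ (g1 l L (S.v1 n) (S.v3 n) (S.v5 n)) (g2 L (S.v3 n)) (g3 l L (S.v1 n) (S.v5 n))
    (S.v2 n) (S.v4 n) (S.v6 n)

/-- energy density of the data -/
def eF (S : BresseSetting ρ₁ ρ₂ k₁ k₂ k₃ l L β a₀ 4) (n : ℕ) : ℝ → ℝ :=
  en ρ₁ ρ₂ k₁ k₂ k₃ (g1 l L (S.f1 n) (S.f3 n) (S.f5 n)) (g2 L (S.f3 n)) (g3 l L (S.f1 n) (S.f5 n))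
    (S.f2 n) (S.f4 n) (S.f6 n)

lemma g1_cont (hL : 0 < L) {a b c : ℝ → ℂ} (ha : ContDiffOn ℝ 1 a (Icc 0 L))
    (hb : ContDiffOn ℝ 1 b (Icc 0 L)) (hc : ContDiffOn ℝ 1 c (Icc 0 L)) :
    ContinuousOn (g1 l L a b c) (Icc 0 L) :=
  ((c1d hL ha).add hb.continuousOn).add (hc.continuousOn.const_mul _)

lemma g2_cont (hL : 0 < L) {b : ℝ → ℂ} (hb : ContDiffOn ℝ 1 b (Icc 0 L)) :
    ContinuousOn (g2 L b) (Icc 0 L) := c1d hL hb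

lemma g3_cont (hL : 0 < L) {a c : ℝ → ℂ} (ha : ContDiffOn ℝ 1 a (Icc 0 L))
    (hc : ContDiffOn ℝ 1 c (Icc 0 L)) : ContinuousOn (g3 l L a c) (Icc 0 L) :=
  (c1d hL hc).sub (ha.continuousOn.const_mul _)

variable (S : BresseSetting ρ₁ ρ₂ k₁ k₂ k₃ l L β a₀ 4)

lemma r1 (n : ℕ) : ContDiffOn ℝ 1 (S.v1 n) (Icc 0 L) := (S.reg_v1 n).of_le (by norm_num)
lemma r3 (n : ℕ) : ContDiffOn ℝ 1 (S.v3 n) (Icc 0 L) := (S.reg_v3 n).of_le (by norm_num)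

lemma eU_cont (hL : 0 < L) (n : ℕ) : ContinuousOn (eU S n) (Icc 0 L) :=
  en_cont (g1_cont hL (r1 S n) (r3 S n) (S.reg_v5 n)) (g2_cont hL (r3 S n))
    (g3_cont hL (r1 S n) (S.reg_v5 n)) (S.reg_v2 n).continuousOn (S.reg_v4 n).continuousOn
    (S.reg_v6 n).continuousOn

lemma eF_cont (hL : 0 < L) (n : ℕ) : ContinuousOn (eF S n) (Icc 0 L) :=
  en_cont (g1_cont hL (S.reg_f1 n) (S.reg_f3 n) (S.reg_f5 n)) (g2_cont hL (S.reg_f3 n))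
    (g3_cont hL (S.reg_f1 n) (S.reg_f5 n)) (S.reg_f2 n) (S.reg_f4 n) (S.reg_f6 n)

lemma eU_int (hL : 0 < L) (n : ℕ) : (∫ x in (0 : ℝ)..L, eU S n x) = 1 := by
  rw [← S.normU n]
  refine integral_congr_Ioo' hL.le fun x hx => ?_
  simp only [eU, en, g1, g2, g3, c1e hx]

lemma eF_int (hL : 0 < L) : Tendsto (fun n => ∫ x in (0 : ℝ)..L, eF S n x) atTop (nhds 0) := by
  refine S.normF.congr fun n => ?_
  refine integral_congr_Ioo' hL.le fun x hx => ?_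
  simp only [eF, en, g1, g2, g3, c1e hx]

lemma cz (n : ℕ) : (S.lam n : ℂ) ^ (-((4 : ℕ) : ℤ)) = (((S.lam n ^ 4)⁻¹ : ℝ) : ℂ) := by
  rw [zpow_neg, zpow_natCast]; push_cast; rfl

lemma dseg (hr1 : 0 < ρ₁) (hr2 : 0 < ρ₂) (hk1 : 0 < k₁) (hk2 : 0 < k₂) (hk3 : 0 < k₃)
    (hL : 0 < L) {δ α γ a : ℝ} (hδ : 0 < δ) (hab : α ≤ γ) (hs : Icc α γ ⊆ Icc 0 L)
    (hso : Ioo α γ ⊆ Ioo 0 L)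
    (hso2 : Ioo α γ ⊆ Ioo 0 β ∪ Ioo β L) (n : ℕ) (h5 : ContDiffOn ℝ 2 (S.v5 n) (Icc α γ))
    (ha : ∀ x ∈ Ioo α γ, (if x < β then (a₀ : ℂ) else 0) = (a : ℂ)) :
    a * (∫ x in α..γ, ‖S.v6 n x‖ ^ 2) ≤
      (k₁ * g1 l L (S.v1 n) (S.v3 n) (S.v5 n) γ * conj (S.v2 n γ) + k₂ * g2 L (S.v3 n) γ *
        conj (S.v4 n γ) + k₃ * g3 l L (S.v1 n) (S.v5 n) γ * conj (S.v6 n γ)).re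
      - (k₁ * g1 l L (S.v1 n) (S.v3 n) (S.v5 n) α * conj (S.v2 n α) + k₂ * g2 L (S.v3 n) α *
        conj (S.v4 n α) + k₃ * g3 l L (S.v1 n) (S.v5 n) α * conj (S.v6 n α)).re
      + (S.lam n ^ 4)⁻¹ * ((δ * (∫ x in α..γ, eU S n x) + δ⁻¹ * (∫ x in α..γ, eF S n x)) / 2) := by
  have dv : ∀ {f : ℝ → ℂ}, ContDiffOn ℝ 1 f (Icc 0 L) → ∀ x ∈ Ioo α γ,
      HasDerivAt f (derivWithin f (Icc 0 L) x) x := fun hf x hx => c1h hf (hso hx)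
  have nb : ∀ x ∈ Ioo α γ, ∀ᶠ y in nhds x, y ∈ Ioo α γ := fun x hx => Ioo_mem_nhds hx.1 hx.2
  have key : ∀ {f p g : ℝ → ℂ}, ContDiffOn ℝ 1 f (Icc 0 L) → ContDiffOn ℝ 1 p (Icc 0 L) →
      (∀ x ∈ Ioo α γ, Complex.I * (S.lam n : ℂ) * f x - g x = (((S.lam n ^ 4)⁻¹ : ℝ) : ℂ) * p x) →
      ∀ x ∈ Ioo α γ, HasDerivAt g (Complex.I * S.lam n * derivWithin f (Icc 0 L) x
        - (((S.lam n ^ 4)⁻¹ : ℝ) : ℂ) * derivWithin p (Icc 0 L) x) x := by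
    intro f p g hf hp h x hx
    refine (((dv hf x hx).const_mul (Complex.I * (S.lam n : ℂ))).sub
      ((dv hp x hx).const_mul (((S.lam n ^ 4)⁻¹ : ℝ) : ℂ))).congr_of_eventuallyEq ?_
    filter_upwards [nb x hx] with y hy
    have := h y hy
    simp only [Pi.sub_apply]
    linear_combination -this
  have q1 : ∀ x ∈ Ioo α γ, Complex.I * (S.lam n : ℂ) * S.v1 n x - S.v2 n x
      = (((S.lam n ^ 4)⁻¹ : ℝ) : ℂ) * S.f1 n x := fun x hx => by
    rw [← cz S n]; exact S.eq1 n x (hso2 hx)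
  have q3 : ∀ x ∈ Ioo α γ, Complex.I * (S.lam n : ℂ) * S.v3 n x - S.v4 n x
      = (((S.lam n ^ 4)⁻¹ : ℝ) : ℂ) * S.f3 n x := fun x hx => by
    rw [← cz S n]; exact S.eq3 n x (hso2 hx)
  have q5 : ∀ x ∈ Ioo α γ, Complex.I * (S.lam n : ℂ) * S.v5 n x - S.v6 n x
      = (((S.lam n ^ 4)⁻¹ : ℝ) : ℂ) * S.f5 n x := fun x hx => by
    rw [← cz S n]; exact S.eq5 n x (hso2 hx)
  refine seg (lm := S.lam n) (l := l) hr1 hr2 hk1 hk2 hk3 (by positivity) hδ hab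
    ((g1_cont hL (r1 S n) (r3 S n) (S.reg_v5 n)).mono hs) ((g2_cont hL (r3 S n)).mono hs)
    ((g3_cont hL (r1 S n) (S.reg_v5 n)).mono hs) ((S.reg_v2 n).continuousOn.mono hs)
    ((S.reg_v4 n).continuousOn.mono hs) ((S.reg_v6 n).continuousOn.mono hs)
    ((g1_cont hL (S.reg_f1 n) (S.reg_f3 n) (S.reg_f5 n)).mono hs)
    ((g2_cont hL (S.reg_f3 n)).mono hs) ((g3_cont hL (S.reg_f1 n) (S.reg_f5 n)).mono hs)
    ((S.reg_f2 n).mono hs) ((S.reg_f4 n).mono hs) ((S.reg_f6 n).mono hs) ?_ ?_ ?_ ?_ ?_ ?_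
  · intro x hx
    have hd : DifferentiableAt ℝ (fun y => deriv (S.v1 n) y + S.v3 n y + (l : ℂ) * S.v5 n y) x :=
      ((c2d (S.reg_v1 n) (hso hx)).add (dv (r3 S n) x hx).differentiableAt).add
        ((dv (S.reg_v5 n) x hx).differentiableAt.const_mul _)
    have h2 := (hd.hasDerivAt.const_mul (k₁ : ℂ))
    have h3 : HasDerivAt (fun y => (k₁ : ℂ) * g1 l L (S.v1 n) (S.v3 n) (S.v5 n) y) _ x :=
      h2.congr_of_eventuallyEq (by
        filter_upwards [nb x hx] with y hy
        simp only [g1, c1e (hso hy)])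
    refine h3.congr_deriv ?_
    have := S.eq2 n x (hso2 hx)
    rw [cz] at this
    simp only [g3, c1e (hso hx)]
    linear_combination -this
  · intro x hx
    have h2 := ((c2d (S.reg_v3 n) (hso hx)).hasDerivAt.const_mul (k₂ : ℂ))
    have h3 : HasDerivAt (fun y => (k₂ : ℂ) * g2 L (S.v3 n) y) _ x :=
      h2.congr_of_eventuallyEq (by
        filter_upwards [nb x hx] with y hy
        simp only [g2, c1e (hso hy)])
    refine h3.congr_deriv ?_
    have := S.eq4 n x (hso2 hx)
    rw [cz] at this
    simp only [g1, c1e (hso hx)]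
    linear_combination -this
  · intro x hx
    have hd : DifferentiableAt ℝ (fun y => deriv (S.v5 n) y - (l : ℂ) * S.v1 n y) x :=
      (c2d h5 hx).sub ((dv (r1 S n) x hx).differentiableAt.const_mul _)
    have h2 := (hd.hasDerivAt.const_mul (k₃ : ℂ))
    have h3 : HasDerivAt (fun y => (k₃ : ℂ) * g3 l L (S.v1 n) (S.v5 n) y) _ x :=
      h2.congr_of_eventuallyEq (by
        filter_upwards [nb x hx] with y hy
        simp only [g3, c1e (hso hy)])
    refine h3.congr_deriv ?_
    have := S.eq6 n x (hso2 hx)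
    rw [cz, ha x hx] at this
    simp only [g1, c1e (hso hx)]
    linear_combination -this
  · intro x hx
    refine (key (r1 S n) (S.reg_f1 n) q1 x hx).congr_deriv ?_
    simp only [g1]
    linear_combination -(q3 x hx) - l * q5 x hx
  · intro x hx
    refine (key (r3 S n) (S.reg_f3 n) q3 x hx).congr_deriv ?_
    simp only [g2]
  · intro x hx
    refine (key (S.reg_v5 n) (S.reg_f5 n) q5 x hx).congr_deriv ?_
    simp only [g3]
    linear_combination l * q1 x hx

lemma diss (hr1 : 0 < ρ₁) (hr2 : 0 < ρ₂) (hk1 : 0 < k₁) (hk2 : 0 < k₂) (hk3 : 0 < k₃)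
    (hL : 0 < L) (hb : 0 < β) (hbL : β < L) (n : ℕ) {δ : ℝ} (hδ : 0 < δ) :
    a₀ * (S.lam n ^ 4 * ∫ x in (0 : ℝ)..β, ‖S.v6 n x‖ ^ 2) ≤
      (δ + δ⁻¹ * ∫ x in (0 : ℝ)..L, eF S n x) / 2 := by
  have A := dseg S hr1 hr2 hk1 hk2 hk3 hL (a := a₀) hδ hb.le (Icc_subset_Icc_right hbL.le)
    (Ioo_subset_Ioo_right hbL.le) subset_union_left n (S.reg_v5_left n)
    (fun x hx => if_pos hx.2)
  have B := dseg S hr1 hr2 hk1 hk2 hk3 hL (a := 0) hδ hbL.le (Icc_subset_Icc_left hb.le)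
    (Ioo_subset_Ioo_left hb.le) subset_union_right n (S.reg_v5_right n)
    (fun x hx => by rw [if_neg (not_lt.2 hx.1.le)]; simp)
  obtain ⟨-, z2, -, z4, -, z6, -⟩ := S.bc_zero n
  obtain ⟨-, y2, -, y4, -, y6, -⟩ := S.bc_L n
  rw [z2, z4, z6] at A
  rw [y2, y4, y6] at B
  simp only [map_zero, mul_zero, add_zero, Complex.zero_re, sub_zero, zero_mul, zero_sub] at A B
  have cu := eU_cont S hL n
  have cf := eF_cont S hL n
  have hU := intervalIntegral.integral_add_adjacent_intervals
    (ii_cont hb.le (cu.mono (Icc_subset_Icc_right hbL.le)))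
    (ii_cont hbL.le (cu.mono (Icc_subset_Icc_left hb.le)))
  have hF := intervalIntegral.integral_add_adjacent_intervals
    (ii_cont hb.le (cf.mono (Icc_subset_Icc_right hbL.le)))
    (ii_cont hbL.le (cf.mono (Icc_subset_Icc_left hb.le)))
  rw [eU_int S hL n] at hU
  have hp : 0 < S.lam n ^ 4 := (by decide : Even 4).pow_pos (S.lam_ne n)
  have C : a₀ * (∫ x in (0 : ℝ)..β, ‖S.v6 n x‖ ^ 2) ≤
      (S.lam n ^ 4)⁻¹ * ((δ * 1 + δ⁻¹ * ∫ x in (0 : ℝ)..L, eF S n x) / 2) := by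
    rw [← hU, ← hF]
    linarith
  have := mul_le_mul_of_nonneg_left C hp.le
  rw [mul_inv_cancel_left₀ hp.ne'] at this
  linarith

lemma en_nonneg {r1 r2 k1 k2 k3 : ℝ} (hr1 : 0 < r1) (hr2 : 0 < r2) (hk1 : 0 < k1)
    (hk2 : 0 < k2) (hk3 : 0 < k3) (a1 a2 a3 b2 b4 b6 : ℝ → ℂ) (x : ℝ) :
    0 ≤ en r1 r2 k1 k2 k3 a1 a2 a3 b2 b4 b6 x := by
  unfold en; positivity

lemma v6_lim (hr1 : 0 < ρ₁) (hr2 : 0 < ρ₂) (hk1 : 0 < k₁) (hk2 : 0 < k₂) (hk3 : 0 < k₃)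
    (hL : 0 < L) (ha : 0 < a₀) (hb : 0 < β) (hbL : β < L) :
    Tendsto (fun n => S.lam n ^ 4 * ∫ x in (0 : ℝ)..β, ‖S.v6 n x‖ ^ 2) atTop (nhds 0) := by
  have hn : ∀ n, 0 ≤ S.lam n ^ 4 * ∫ x in (0 : ℝ)..β, ‖S.v6 n x‖ ^ 2 := fun n => by
    have : 0 ≤ ∫ x in (0 : ℝ)..β, ‖S.v6 n x‖ ^ 2 :=
      intervalIntegral.integral_nonneg hb.le (fun x _ => by positivity)
    positivity
  rw [Metric.tendsto_atTop]
  intro ε hε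
  have hδ : 0 < ε * a₀ := mul_pos hε ha
  have := (eF_int S hL).eventually_lt_const (u := (ε * a₀) ^ 2 / 2) (by positivity)
  obtain ⟨N, hN⟩ := eventually_atTop.1 this
  refine ⟨N, fun n hn' => ?_⟩
  rw [Real.dist_0_eq_abs, abs_of_nonneg (hn n)]
  have h1 := diss S hr1 hr2 hk1 hk2 hk3 hL hb hbL n hδ
  have h2 := hN n hn'
  have h3 : (ε * a₀)⁻¹ * ∫ x in (0 : ℝ)..L, eF S n x ≤ ε * a₀ / 2 := by
    rw [inv_mul_le_iff₀ hδ]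
    linarith
  by_contra hcon
  push Not at hcon
  have := mul_le_mul_of_nonneg_left hcon ha.le
  linarith

lemma f_ptw (hr1 : 0 < ρ₁) (hr2 : 0 < ρ₂) (hk1 : 0 < k₁) (hk2 : 0 < k₂) (hk3 : 0 < k₃)
    (hL : 0 < L) (n : ℕ) {x : ℝ} (hx : x ∈ Icc 0 L) :
    ‖S.f1 n x‖ ^ 2 + ‖S.f3 n x‖ ^ 2 + ‖S.f5 n x‖ ^ 2 ≤
      Real.exp (2 * L) * ((k₁⁻¹ + k₂⁻¹ + k₃⁻¹) * ∫ y in (0 : ℝ)..L, eF S n y) := by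
  obtain ⟨-, -, -, -, -, -, h1, h3, h5⟩ := S.bc_zero n
  have c1 := g1_cont (l := l) hL (S.reg_f1 n) (S.reg_f3 n) (S.reg_f5 n)
  have c2 := g2_cont hL (S.reg_f3 n)
  have c3 := g3_cont (l := l) hL (S.reg_f1 n) (S.reg_f5 n)
  have h := ptw (l := l) hL (S.reg_f1 n).continuousOn (S.reg_f3 n).continuousOn
    (S.reg_f5 n).continuousOn c1 c2 c3
    (fun y hy => (c1h (S.reg_f1 n) hy).congr_deriv (by simp only [g1]; ring))
    (fun y hy => (c1h (S.reg_f3 n) hy).congr_deriv (by simp only [g2]))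
    (fun y hy => (c1h (S.reg_f5 n) hy).congr_deriv (by simp only [g3]; ring)) h1 h3 h5 hx
  refine h.trans (mul_le_mul_of_nonneg_left ?_ (Real.exp_pos _).le)
  rw [← intervalIntegral.integral_const_mul]
  have cc := (eF_cont S hL n).const_mul (k₁⁻¹ + k₂⁻¹ + k₃⁻¹)
  refine intervalIntegral.integral_mono_on hL.le
    (ii_cont hL.le (((c1.norm.pow 2).add (c2.norm.pow 2)).add (c3.norm.pow 2)))
    (ii_cont hL.le cc) fun y _ => ?_
  generalize hX : g1 l L (S.f1 n) (S.f3 n) (S.f5 n) y = X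
  generalize hY : g2 L (S.f3 n) y = Y
  generalize hZ : g3 l L (S.f1 n) (S.f5 n) y = Z
  have e0 : 0 ≤ ρ₁ * ‖S.f2 n y‖ ^ 2 + ρ₂ * ‖S.f4 n y‖ ^ 2 + ρ₁ * ‖S.f6 n y‖ ^ 2 := by positivity
  have p1 : 0 ≤ k₁ * ‖X‖ ^ 2 := by positivity
  have p2 : 0 ≤ k₂ * ‖Y‖ ^ 2 := by positivity
  have p3 : 0 ≤ k₃ * ‖Z‖ ^ 2 := by positivity
  have e : eF S n y = k₁ * ‖X‖ ^ 2 + ρ₁ * ‖S.f2 n y‖ ^ 2 + k₂ * ‖Y‖ ^ 2 + ρ₂ * ‖S.f4 n y‖ ^ 2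
      + k₃ * ‖Z‖ ^ 2 + ρ₁ * ‖S.f6 n y‖ ^ 2 := by
    simp only [eF, en, hX, hY, hZ]
  have a1 : ‖X‖ ^ 2 ≤ k₁⁻¹ * eF S n y := by
    rw [inv_mul_eq_div, le_div_iff₀ hk1]; linarith
  have a2 : ‖Y‖ ^ 2 ≤ k₂⁻¹ * eF S n y := by
    rw [inv_mul_eq_div, le_div_iff₀ hk2]; linarith
  have a3 : ‖Z‖ ^ 2 ≤ k₃⁻¹ * eF S n y := by
    rw [inv_mul_eq_div, le_div_iff₀ hk3]; linarith
  linarith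

end assemble

section final
variable {ρ₁ ρ₂ k₁ k₂ k₃ l L a₀ : ℝ} (S : BresseSetting ρ₁ ρ₂ k₁ k₂ k₃ l L β a₀ 4)

lemma toCt {f : ℕ → ℝ → ℂ} (hbL : β < L) (h : ∀ n, ContinuousOn (f n) (Icc 0 L)) : Ct β f :=
  fun n => (h n).mono fun _ hx => ⟨hx.1.le, (hx.2.trans hbL).le⟩

lemma bdU (hL : 0 < L) (hbL : β < L) {k : ℝ} (hk : 0 < k) {f : ℕ → ℝ → ℂ}
    (hf : ∀ n, ContinuousOn (f n) (Icc 0 L)) (hle : ∀ n x, k * ‖f n x‖ ^ 2 ≤ eU S n x) :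
    Bd S.lam β 0 f := by
  refine Bd_of_le (M := k⁻¹ * 1) (toCt hbL hf) fun a b ha hab hb n => ?_
  have := Nm_zero_le (lam := S.lam) hk ha hab hb hbL n (hf n) (eU_cont S hL n) (hle n)
  rwa [eU_int S hL n] at this

lemma smF (hL : 0 < L) (hbL : β < L) {k : ℝ} (hk : 0 < k) {f : ℕ → ℝ → ℂ}
    (hf : ∀ n, ContinuousOn (f n) (Icc 0 L)) (hle : ∀ n x, k * ‖f n x‖ ^ 2 ≤ eF S n x) :
    Sm S.lam β 0 f := by
  have hM := (eF_int S hL).const_mul k⁻¹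
  rw [mul_zero] at hM
  exact Sm_of_le (toCt hbL hf) hM fun a b ha hab hb n =>
    Nm_zero_le hk ha hab hb hbL n (hf n) (eF_cont S hL n) (hle n)

lemma smP (hr1 : 0 < ρ₁) (hr2 : 0 < ρ₂) (hk1 : 0 < k₁) (hk2 : 0 < k₂) (hk3 : 0 < k₃)
    (hL : 0 < L) (hbL : β < L) {f : ℕ → ℝ → ℂ}
    (hf : ∀ n, ContinuousOn (f n) (Icc 0 L))
    (hle : ∀ n x, ‖f n x‖ ^ 2 ≤ ‖S.f1 n x‖ ^ 2 + ‖S.f3 n x‖ ^ 2 + ‖S.f5 n x‖ ^ 2) :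
    Sm S.lam β 0 f := by
  have hM := (((eF_int S hL).const_mul (k₁⁻¹ + k₂⁻¹ + k₃⁻¹)).const_mul
    (Real.exp (2 * L))).mul_const L
  rw [mul_zero, mul_zero, zero_mul] at hM
  refine Sm_of_le (toCt hbL hf) hM fun a b ha hab hb n => ?_
  have hs : Icc a b ⊆ Icc 0 L := Icc_subset_Icc ha.le (hb.trans hbL).le
  have h1 := intervalIntegral.integral_mono_on hab.le
    (ii_cont hab.le (((hf n).norm.pow 2).mono hs))
    (ii_cont hab.le (continuousOn_const (c := Real.exp (2 * L) * ((k₁⁻¹ + k₂⁻¹ + k₃⁻¹) *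
      ∫ y in (0 : ℝ)..L, eF S n y))))
    (fun x hx => (hle n x).trans (f_ptw S hr1 hr2 hk1 hk2 hk3 hL n (hs hx)))
  have h0 : 0 ≤ Real.exp (2 * L) * ((k₁⁻¹ + k₂⁻¹ + k₃⁻¹) * ∫ y in (0 : ℝ)..L, eF S n y) :=
    le_trans (by positivity) (f_ptw S hr1 hr2 hk1 hk2 hk3 hL n (left_mem_Icc.2 hL.le))
  rw [intervalIntegral.integral_const, smul_eq_mul] at h1
  unfold Nm
  simp only [zpow_zero, one_pow, one_mul]
  refine h1.trans ?_
  rw [mul_comm]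
  exact mul_le_mul_of_nonneg_left (by linarith) h0

theorem loc (hr1 : 0 < ρ₁) (hr2 : 0 < ρ₂) (hk1 : 0 < k₁) (hk2 : 0 < k₂) (hk3 : 0 < k₃)
    (hL : 0 < L) (ha : 0 < a₀) (hb : 0 < β) (hbL : β < L) :
    Loc S.lam β ρ₁ ρ₂ k₁ k₂ k₃ l a₀ S.v1 (fun n => deriv (S.v1 n))
      (fun n => deriv (deriv (S.v1 n))) S.v3 (fun n => deriv (S.v3 n))
      (fun n => deriv (deriv (S.v3 n))) S.v5 (fun n => deriv (S.v5 n))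
      (fun n => deriv (deriv (S.v5 n)))
      (fun n x => -ρ₁ * (((S.lam n : ℂ) ^ 4)⁻¹ * S.f2 n x)
        + -(Complex.I * ρ₁) * (((S.lam n : ℂ) ^ 3)⁻¹ * S.f1 n x))
      (fun n x => -ρ₂ * (((S.lam n : ℂ) ^ 4)⁻¹ * S.f4 n x)
        + -(Complex.I * ρ₂) * (((S.lam n : ℂ) ^ 3)⁻¹ * S.f3 n x))
      (fun n x => -ρ₁ * (((S.lam n : ℂ) ^ 4)⁻¹ * S.f6 n x)
        + -(Complex.I * ρ₁) * (((S.lam n : ℂ) ^ 3)⁻¹ * S.f5 n x)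
        + -a₀ * (((S.lam n : ℂ) ^ 4)⁻¹ * S.f5 n x)) := by
  have hl := S.lam_ne
  have hlt := S.lam_tendsto
  have hio : ∀ {x}, x ∈ Ioo 0 β → x ∈ Ioo 0 L := fun hx => ⟨hx.1, hx.2.trans hbL⟩
  have hc : ∀ n, (S.lam n : ℂ) ≠ 0 := fun n => by exact_mod_cast hl n
  have cz4 : ∀ n, (S.lam n : ℂ) ^ (-((4 : ℕ) : ℤ)) = ((S.lam n : ℂ) ^ 4)⁻¹ := fun n => by
    rw [zpow_neg, zpow_natCast]
  have cz3 : ∀ n, ((S.lam n : ℂ) ^ 3)⁻¹ = S.lam n * ((S.lam n : ℂ) ^ 4)⁻¹ := fun n => by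
    have := hc n
    field_simp
  have D : ∀ {f : ℕ → ℝ → ℂ}, (∀ n, ContDiffOn ℝ 1 (f n) (Icc 0 L)) → ∀ n, ∀ x ∈ Ioo 0 β,
      HasDerivAt (f n) (deriv (f n) x) x := fun hf n x hx => by
    have := c1h (hf n) (hio hx)
    rwa [c1e (hio hx)] at this
  have q1 : ∀ n, ∀ x ∈ Ioo 0 β, Complex.I * (S.lam n : ℂ) * S.v1 n x - S.v2 n x
      = ((S.lam n : ℂ) ^ 4)⁻¹ * S.f1 n x := fun n x hx => by
    rw [← cz4 n]; exact S.eq1 n x (Or.inl hx)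
  have q3 : ∀ n, ∀ x ∈ Ioo 0 β, Complex.I * (S.lam n : ℂ) * S.v3 n x - S.v4 n x
      = ((S.lam n : ℂ) ^ 4)⁻¹ * S.f3 n x := fun n x hx => by
    rw [← cz4 n]; exact S.eq3 n x (Or.inl hx)
  have q5 : ∀ n, ∀ x ∈ Ioo 0 β, Complex.I * (S.lam n : ℂ) * S.v5 n x - S.v6 n x
      = ((S.lam n : ℂ) ^ 4)⁻¹ * S.f5 n x := fun n x hx => by
    rw [← cz4 n]; exact S.eq5 n x (Or.inl hx)
  -- pieces of the energies
  have tU : ∀ n x, eU S n x = _ := fun n x => rfl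
  have b2 : Bd S.lam β 0 S.v2 := bdU S hL hbL hr1 (fun n => (S.reg_v2 n).continuousOn) fun n x => by
    simp only [eU, en]
    have : 0 ≤ k₁ * ‖g1 l L (S.v1 n) (S.v3 n) (S.v5 n) x‖ ^ 2 + k₂ * ‖g2 L (S.v3 n) x‖ ^ 2
      + ρ₂ * ‖S.v4 n x‖ ^ 2 + k₃ * ‖g3 l L (S.v1 n) (S.v5 n) x‖ ^ 2 + ρ₁ * ‖S.v6 n x‖ ^ 2 := by
      positivity
    linarith
  have b4 : Bd S.lam β 0 S.v4 := bdU S hL hbL hr2 (fun n => (S.reg_v4 n).continuousOn) fun n x => by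
    simp only [eU, en]
    have : 0 ≤ k₁ * ‖g1 l L (S.v1 n) (S.v3 n) (S.v5 n) x‖ ^ 2 + k₂ * ‖g2 L (S.v3 n) x‖ ^ 2
      + ρ₁ * ‖S.v2 n x‖ ^ 2 + k₃ * ‖g3 l L (S.v1 n) (S.v5 n) x‖ ^ 2 + ρ₁ * ‖S.v6 n x‖ ^ 2 := by
      positivity
    linarith
  have bg1 : Bd S.lam β 0 (fun n => g1 l L (S.v1 n) (S.v3 n) (S.v5 n)) :=
    bdU S hL hbL hk1 (fun n => g1_cont hL (r1 S n) (r3 S n) (S.reg_v5 n)) fun n x => by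
    simp only [eU, en]
    have : 0 ≤ ρ₁ * ‖S.v2 n x‖ ^ 2 + k₂ * ‖g2 L (S.v3 n) x‖ ^ 2
      + ρ₂ * ‖S.v4 n x‖ ^ 2 + k₃ * ‖g3 l L (S.v1 n) (S.v5 n) x‖ ^ 2 + ρ₁ * ‖S.v6 n x‖ ^ 2 := by
      positivity
    linarith
  have bg2 : Bd S.lam β 0 (fun n => g2 L (S.v3 n)) :=
    bdU S hL hbL hk2 (fun n => g2_cont hL (r3 S n)) fun n x => by
    simp only [eU, en]
    have : 0 ≤ k₁ * ‖g1 l L (S.v1 n) (S.v3 n) (S.v5 n) x‖ ^ 2 + ρ₁ * ‖S.v2 n x‖ ^ 2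
      + ρ₂ * ‖S.v4 n x‖ ^ 2 + k₃ * ‖g3 l L (S.v1 n) (S.v5 n) x‖ ^ 2 + ρ₁ * ‖S.v6 n x‖ ^ 2 := by
      positivity
    linarith
  have bg3 : Bd S.lam β 0 (fun n => g3 l L (S.v1 n) (S.v5 n)) :=
    bdU S hL hbL hk3 (fun n => g3_cont hL (r1 S n) (S.reg_v5 n)) fun n x => by
    simp only [eU, en]
    have : 0 ≤ k₁ * ‖g1 l L (S.v1 n) (S.v3 n) (S.v5 n) x‖ ^ 2 + k₂ * ‖g2 L (S.v3 n) x‖ ^ 2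
      + ρ₂ * ‖S.v4 n x‖ ^ 2 + ρ₁ * ‖S.v2 n x‖ ^ 2 + ρ₁ * ‖S.v6 n x‖ ^ 2 := by
      positivity
    linarith
  have s2 : Sm S.lam β 0 S.f2 := smF S hL hbL hr1 S.reg_f2 fun n x => by
    simp only [eF, en]
    have : 0 ≤ k₁ * ‖g1 l L (S.f1 n) (S.f3 n) (S.f5 n) x‖ ^ 2 + k₂ * ‖g2 L (S.f3 n) x‖ ^ 2
      + ρ₂ * ‖S.f4 n x‖ ^ 2 + k₃ * ‖g3 l L (S.f1 n) (S.f5 n) x‖ ^ 2 + ρ₁ * ‖S.f6 n x‖ ^ 2 := by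
      positivity
    linarith
  have s4 : Sm S.lam β 0 S.f4 := smF S hL hbL hr2 S.reg_f4 fun n x => by
    simp only [eF, en]
    have : 0 ≤ k₁ * ‖g1 l L (S.f1 n) (S.f3 n) (S.f5 n) x‖ ^ 2 + k₂ * ‖g2 L (S.f3 n) x‖ ^ 2
      + ρ₁ * ‖S.f2 n x‖ ^ 2 + k₃ * ‖g3 l L (S.f1 n) (S.f5 n) x‖ ^ 2 + ρ₁ * ‖S.f6 n x‖ ^ 2 := by
      positivity
    linarith
  have s6 : Sm S.lam β 0 S.f6 := smF S hL hbL hr1 S.reg_f6 fun n x => by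
    simp only [eF, en]
    have : 0 ≤ k₁ * ‖g1 l L (S.f1 n) (S.f3 n) (S.f5 n) x‖ ^ 2 + k₂ * ‖g2 L (S.f3 n) x‖ ^ 2
      + ρ₂ * ‖S.f4 n x‖ ^ 2 + k₃ * ‖g3 l L (S.f1 n) (S.f5 n) x‖ ^ 2 + ρ₁ * ‖S.f2 n x‖ ^ 2 := by
      positivity
    linarith
  have s1 : Sm S.lam β 0 S.f1 := smP S hr1 hr2 hk1 hk2 hk3 hL hbL
    (fun n => (S.reg_f1 n).continuousOn) fun n x => by
      have : 0 ≤ ‖S.f3 n x‖ ^ 2 + ‖S.f5 n x‖ ^ 2 := by positivity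
      linarith
  have s3 : Sm S.lam β 0 S.f3 := smP S hr1 hr2 hk1 hk2 hk3 hL hbL
    (fun n => (S.reg_f3 n).continuousOn) fun n x => by
      have : 0 ≤ ‖S.f1 n x‖ ^ 2 + ‖S.f5 n x‖ ^ 2 := by positivity
      linarith
  have s5 : Sm S.lam β 0 S.f5 := smP S hr1 hr2 hk1 hk2 hk3 hL hbL
    (fun n => (S.reg_f5 n).continuousOn) fun n x => by
      have : 0 ≤ ‖S.f1 n x‖ ^ 2 + ‖S.f3 n x‖ ^ 2 := by positivity
      linarith
  have s66 : Sm S.lam β 2 S.v6 := by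
    refine Sm_of_le (toCt hbL fun n => (S.reg_v6 n).continuousOn)
      (v6_lim S hr1 hr2 hk1 hk2 hk3 hL ha hb hbL) fun a b ha' hab hb' n => ?_
    have h1 : (∫ x in a..b, ‖S.v6 n x‖ ^ 2) ≤ ∫ x in (0 : ℝ)..β, ‖S.v6 n x‖ ^ 2 := by
      apply intervalIntegral.integral_mono_interval ha'.le hab.le hb'.le
      · exact Eventually.of_forall fun y => by positivity
      · exact ii_cont hb.le ((((S.reg_v6 n).continuousOn.norm).pow 2).mono
          (Icc_subset_Icc_right hbL.le))
    have h2 : (|S.lam n| ^ (2 : ℤ)) ^ 2 = S.lam n ^ 4 := by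
      rw [show (2 : ℤ) = ((2 : ℕ) : ℤ) from rfl, zpow_natCast, sq_abs]; ring
    unfold Nm
    rw [h2]
    exact mul_le_mul_of_nonneg_left h1 (by positivity)
  have hu : Bd S.lam β 1 S.v1 := by
    have := (((b2.add ((s1.inv hl 4).bd.mono hlt (i := 0) (by norm_num))).inv hl 1).smul
      (-Complex.I))
    refine this.congr fun n x hx => ?_
    rw [← q1 n x hx]
    have := hc n
    field_simp
    linear_combination (S.lam n * S.v1 n x : ℂ) * Complex.I_sq
  have hw : Bd S.lam β 1 S.v3 := by
    have := (((b4.add ((s3.inv hl 4).bd.mono hlt (i := 0) (by norm_num))).inv hl 1).smul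
      (-Complex.I))
    refine this.congr fun n x hx => ?_
    rw [← q3 n x hx]
    have := hc n
    field_simp
    linear_combination (S.lam n * S.v3 n x : ℂ) * Complex.I_sq
  have hz : Sm S.lam β 3 S.v5 := by
    have := (((s66.add ((s5.inv hl 4).mono hlt (i := 2) (by norm_num))).inv hl 1).smul
      (-Complex.I))
    refine this.congr fun n x hx => ?_
    rw [← q5 n x hx]
    have := hc n
    field_simp
    linear_combination (S.lam n * S.v5 n x : ℂ) * Complex.I_sq
  have dd1 : ∀ n, ∀ x ∈ Ioo 0 β, HasDerivAt (deriv (S.v1 n)) (deriv (deriv (S.v1 n)) x) x :=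
    fun n x hx => (c2d (S.reg_v1 n) (hio hx)).hasDerivAt
  have dd3 : ∀ n, ∀ x ∈ Ioo 0 β, HasDerivAt (deriv (S.v3 n)) (deriv (deriv (S.v3 n)) x) x :=
    fun n x hx => (c2d (S.reg_v3 n) (hio hx)).hasDerivAt
  have dd5 : ∀ n, ∀ x ∈ Ioo 0 β, HasDerivAt (deriv (S.v5 n)) (deriv (deriv (S.v5 n)) x) x :=
    fun n x hx => (c2d (S.reg_v5_left n) hx).hasDerivAt
  have D1 := D (r1 S)
  have D3 := D (r3 S)
  have D5 := D S.reg_v5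
  have hw0 := hw.mono hlt (i := 0) (by norm_num)
  have hz0 := hz.bd.mono hlt (i := 0) (by norm_num)
  have hu0 := hu.mono hlt (i := 0) (by norm_num)
  refine
    { hl := hl, hlt := hlt, du := D1, du1 := dd1, dw := D3, dw1 := dd3, dz := D5, dz1 := dd5
      A := ?_, B := ?_, C := ?_, hz := hz, hu := hu, hw := hw, hu1 := ?_, hw1 := ?_, hz1 := ?_
      hR2 := ?_, hR4 := ?_, hR6 := ?_ }
  · intro n x hx
    have h := S.eq2 n x (Or.inl hx)
    have hd : HasDerivAt (fun y => deriv (S.v1 n) y + S.v3 n y + (l : ℂ) * S.v5 n y)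
        (deriv (deriv (S.v1 n)) x + deriv (S.v3 n) x + (l : ℂ) * deriv (S.v5 n) x) x :=
      ((dd1 n x hx).add (D3 n x hx)).add ((D5 n x hx).const_mul _)
    rw [hd.deriv, cz4] at h
    rw [cz3]
    linear_combination -h - (Complex.I * S.lam n * ρ₁) * q1 n x hx
      + (S.lam n ^ 2 * ρ₁ * S.v1 n x : ℂ) * Complex.I_sq
  · intro n x hx
    have h := S.eq4 n x (Or.inl hx)
    rw [cz4] at h
    rw [cz3]
    linear_combination -h - (Complex.I * S.lam n * ρ₂) * q3 n x hx
      + (S.lam n ^ 2 * ρ₂ * S.v3 n x : ℂ) * Complex.I_sq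
  · intro n x hx
    have h := S.eq6 n x (Or.inl hx)
    have hd : HasDerivAt (fun y => deriv (S.v5 n) y - (l : ℂ) * S.v1 n y)
        (deriv (deriv (S.v5 n)) x - (l : ℂ) * deriv (S.v1 n) x) x :=
      (dd5 n x hx).sub ((D1 n x hx).const_mul _)
    rw [hd.deriv, cz4, if_pos hx.2] at h
    rw [cz3]
    linear_combination -h - (Complex.I * S.lam n * ρ₁ + a₀) * q5 n x hx
      + (S.lam n ^ 2 * ρ₁ * S.v5 n x : ℂ) * Complex.I_sq
  · refine ((bg1.add (hw0.smul (-1))).add (hz0.smul (-(l : ℂ)))).congr fun n x hx => ?_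
    simp only [g1, c1e (hio hx)]
    ring
  · refine bg2.congr fun n x hx => ?_
    simp only [g2, c1e (hio hx)]
  · refine (bg3.add (hu0.smul (l : ℂ))).congr fun n x hx => ?_
    simp only [g3, c1e (hio hx)]
    ring
  · exact (((s2.inv hl 4).mono hlt (by norm_num)).smul _).add
      (((s1.inv hl 3).mono hlt (by norm_num)).smul _)
  · exact (((s4.inv hl 4).mono hlt (by norm_num)).smul _).add
      (((s3.inv hl 3).mono hlt (by norm_num)).smul _)
  · exact ((((s6.inv hl 4).mono hlt (by norm_num)).smul _).add
      (((s5.inv hl 3).mono hlt (by norm_num)).smul _)).add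
      (((s5.inv hl 4).mono hlt (by norm_num)).smul _)

end final

end BL

theorem bresse_lemma5_estimates (ρ₁ ρ₂ k₁ k₂ k₃ l L β a₀ : ℝ) (ℓ : ℕ)
    (hrho1 : 0 < ρ₁) (hrho2 : 0 < ρ₂) (hk1 : 0 < k₁) (hk2 : 0 < k₂) (hk3 : 0 < k₃)
    (hl : 0 < l) (hL : 0 < L) (ha0 : 0 < a₀) (hbeta : 0 < β) (hbetaL : β < L)
    (S : BresseSetting ρ₁ ρ₂ k₁ k₂ k₃ l L β a₀ ℓ)
    (hH : k₁ / ρ₁ ≠ k₂ / ρ₂ ∧ ℓ = 4) :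
    ∀ ε : ℝ, 0 < ε → ε < β / 12 →
    Tendsto (fun n => (S.lam n) ^ 4 * ∫ x in (4 * ε)..(β - 4 * ε), ‖S.v1 n x‖ ^ 2)
      atTop (nhds 0) ∧
    Tendsto (fun n => (S.lam n) ^ 2 * ∫ x in (4 * ε)..(β - 4 * ε), ‖deriv (S.v1 n) x‖ ^ 2)
      atTop (nhds 0) := by
  obtain ⟨-, rfl⟩ := hH
  intro ε h0 h1
  have D := BL.loc S hrho1 hrho2 hk1 hk2 hk3 hL ha0 hbeta hbetaL
  have hu1 := (D.s4 hrho1 hrho2 hk1 hk2 hk3 hl).2 (4 * ε) (β - 4 * ε) (by linarith) (by linarith)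
    (by linarith)
  have hu := (D.s5 hrho1 hrho2 hk1 hk2 hk3 hl).2 (4 * ε) (β - 4 * ε) (by linarith) (by linarith)
    (by linarith)
  constructor
  · refine hu.congr fun n => ?_
    have h2 : (|S.lam n| ^ (2 : ℤ)) ^ 2 = S.lam n ^ 4 := by
      rw [show (2 : ℤ) = ((2 : ℕ) : ℤ) from rfl, zpow_natCast, sq_abs]; ring
    simp only [BL.Nm, h2, one_mul]
  · refine hu1.congr fun n => ?_
    have h2 : (|S.lam n| ^ (1 : ℤ)) ^ 2 = S.lam n ^ 2 := by
      rw [zpow_one, sq_abs]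
    simp only [BL.Nm, h2, one_mul]
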